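/- arXiv:2404.03933 — 7 statements merged into one kernel-verified Lean document; each statement's English description precedes it below -/
import Mathlib

section
/- Let l ≥ 3 be an odd integer and q = e^{iπ/l} ∈ ℂ. For every m₁ ∈ ℤ and r₁ ∈ ℕ, the limit of B_{l m₁, l r₁}(v) as v → q, taken over v ∈ ℂ outside the finite set Z_{l r₁}, exists and equals (−1)^{(m₁+1) r₁} · C(m₁, r₁), where C(m₁, r₁) := m₁(m₁−1)⋯(m₁−r₁+1)/r₁! is the generalized binomial coefficient of the integer m₁. -/
open Filter

/-- The rational function `B_{m,r}(v) = ∏_{s=1}^{r} (v^{m-s+1} - v^{-(m-s+1)})/(v^s - v^{-s})`,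
the specialization of the Gaussian binomial coefficient. -/
noncomputable def gaussBinom (m : ℤ) (r : ℕ) (v : ℂ) : ℂ :=
  ∏ i ∈ Finset.range r,
    (v ^ (m - i) - v ^ (-(m - i))) / (v ^ ((i : ℤ) + 1) - v ^ (-((i : ℤ) + 1)))

/-- The set `Z_r = {0} ∪ {v : v^{2s} = 1 for some 1 ≤ s ≤ r}`. -/
def badSet (r : ℕ) : Set ℂ :=
  {0} ∪ {v : ℂ | ∃ s : ℕ, 1 ≤ s ∧ s ≤ r ∧ v ^ (2 * s) = 1}

/-- The generalized binomial coefficient `C(m, r) = m(m-1)⋯(m-r+1)/r!` of an integer `m`. -/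
noncomputable def genBinom (m : ℤ) (r : ℕ) : ℂ :=
  (∏ i ∈ Finset.range r, ((m : ℂ) - i)) / (r.factorial : ℂ)

noncomputable def ff (n : ℤ) (v : ℂ) : ℂ := v ^ n - v ^ (-n)

lemma ff_shift (q : ℂ) (hq : q ≠ 0) (l : ℕ) (hql : q ^ l = -1) (c n : ℤ) :
    ff (l * c + n) q = (-1) ^ c * ff n q := by
  have h1 : q ^ ((l : ℤ) * c) = (-1) ^ c := by
    rw [zpow_mul, zpow_natCast, hql]
  have h2 : ((-1 : ℂ) ^ c)⁻¹ = (-1) ^ c := by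
    rw [← inv_zpow]; norm_num
  unfold ff
  rw [neg_add, zpow_add₀ hq, zpow_add₀ hq, zpow_neg q (l * c), h1, h2]
  ring

lemma ff_tendsto (q : ℂ) (hq : q ≠ 0) (n : ℤ) :
    Tendsto (ff n) (nhdsWithin q {q}ᶜ) (nhds (ff n q)) := by
  have : ContinuousAt (ff n) q := by
    unfold ff
    exact (continuousAt_zpow₀ q n (Or.inl hq)).sub (continuousAt_zpow₀ q (-n) (Or.inl hq))
  exact this.tendsto.mono_left nhdsWithin_le_nhds

lemma ff_deriv (q : ℂ) (hq : q ≠ 0) (l : ℕ) (hql : q ^ l = -1) (c : ℤ) :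
    HasDerivAt (ff (l * c)) (2 * l * c * (-1) ^ c / q) q := by
  have h1 : q ^ ((l : ℤ) * c) = (-1) ^ c := by
    rw [zpow_mul, zpow_natCast, hql]
  have h2 : ((-1 : ℂ) ^ c)⁻¹ = (-1) ^ c := by
    rw [← inv_zpow]; norm_num
  have := (hasDerivAt_zpow (l * c) q (Or.inl hq)).sub (hasDerivAt_zpow (-(l * c)) q (Or.inl hq))
  refine (this.congr_deriv ?_)
  rw [zpow_sub_one₀ hq, zpow_sub_one₀ hq, zpow_neg, h1, h2]
  push_cast
  ring

lemma ff_zero (q : ℂ) (hq : q ≠ 0) (l : ℕ) (hql : q ^ l = -1) (c : ℤ) :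
    ff (l * c) q = 0 := by
  have := ff_shift q hq l hql c 0
  rw [add_zero] at this
  rw [this]; simp [ff]

lemma ff_ratio (q : ℂ) (hq : q ≠ 0) (l : ℕ) (hl : l ≠ 0) (hql : q ^ l = -1) (c d : ℤ)
    (hd : d ≠ 0) :
    Tendsto (fun v => ff (l * c) v / ff (l * d) v) (nhdsWithin q {q}ᶜ)
      (nhds ((-1) ^ (c - d) * (c / d))) := by
  have hc' := hasDerivAt_iff_tendsto_slope.1 (ff_deriv q hq l hql c)
  have hd' := hasDerivAt_iff_tendsto_slope.1 (ff_deriv q hq l hql d)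
  have hlC : (l : ℂ) ≠ 0 := by exact_mod_cast hl
  have hdC : (d : ℂ) ≠ 0 := by exact_mod_cast hd
  have h1 : ((-1 : ℂ)) ^ d ≠ 0 := zpow_ne_zero _ (by norm_num)
  have h := hc'.div hd' (by
    refine div_ne_zero (mul_ne_zero (mul_ne_zero (mul_ne_zero two_ne_zero hlC) hdC) h1) hq)
  have e : (2 * l * c * (-1) ^ c / q) / (2 * l * d * (-1) ^ d / q)
      = ((-1 : ℂ) ^ (c - d) * (c / d)) := by
    rw [zpow_sub₀ (by norm_num)]
    field_simp
  rw [e] at h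
  refine h.congr' ?_
  filter_upwards [self_mem_nhdsWithin] with v hv
  have hv' : v - q ≠ 0 := sub_ne_zero.2 hv
  simp only [Pi.div_apply, slope_def_field, ff_zero q hq l hql, sub_zero]
  rw [div_div_div_cancel_right₀ hv']

lemma block (q : ℂ) (hq : q ≠ 0) (p : ℕ) (hp : Even p) (hql : q ^ (p + 1) = -1)
    (hne : ∀ k < p, ff ((k : ℤ) + 1) q ≠ 0) (m : ℤ) (j : ℕ) :
    Tendsto (fun v => ∏ k ∈ Finset.range (p + 1),
      (ff (((p + 1 : ℕ) : ℤ) * m - (((p + 1) * j + k : ℕ) : ℤ)) v /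
        ff ((((p + 1) * j + k : ℕ) : ℤ) + 1) v)) (nhdsWithin q {q}ᶜ)
      (nhds ((-1) ^ (m + 1) * ((m - j) / (j + 1)))) := by
  have h1 : ((-1 : ℂ)) ≠ 0 := by norm_num
  have hj : ((-1 : ℂ)) ^ (j : ℤ) ≠ 0 := zpow_ne_zero _ h1
  have hjj : ((-1 : ℂ)) ^ (j : ℤ) * (-1) ^ (j : ℤ) = 1 := by
    rw [← mul_zpow]; norm_num
  have hinv : (((-1 : ℂ)) ^ (j : ℤ))⁻¹ = (-1) ^ (j : ℤ) := by
    rw [← inv_zpow]; norm_num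
  have A := ff_ratio q hq (p + 1) (by omega) hql (m - j) (j + 1) (by omega)
  have B : ∀ k ∈ Finset.range p, Tendsto (fun v =>
      ff (((p + 1 : ℕ) : ℤ) * m - (((p + 1) * j + (k + 1) : ℕ) : ℤ)) v /
        ff ((((p + 1) * j + k : ℕ) : ℤ) + 1) v) (nhdsWithin q {q}ᶜ)
      (nhds ((-1 : ℂ) ^ (m + 1))) := by
    intro k hk
    have hk' := hne k (Finset.mem_range.1 hk)
    have e1 : ((p + 1 : ℕ) : ℤ) * m - (((p + 1) * j + (k + 1) : ℕ) : ℤ)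
        = ((p + 1 : ℕ) : ℤ) * (m - j) + (-((k : ℤ) + 1)) := by push_cast; ring
    have e2 : (((p + 1) * j + k : ℕ) : ℤ) + 1 = ((p + 1 : ℕ) : ℤ) * (j : ℤ) + ((k : ℤ) + 1) := by
      push_cast; ring
    rw [e1, e2]
    have e3 : ff (-((k : ℤ) + 1)) q = - ff ((k : ℤ) + 1) q := by
      unfold ff; rw [neg_neg]; ring
    have hb : ff (((p + 1 : ℕ) : ℤ) * (j : ℤ) + ((k : ℤ) + 1)) q ≠ 0 := by
      rw [ff_shift q hq _ hql]
      exact mul_ne_zero hj hk'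
    have h := (ff_tendsto q hq (((p + 1 : ℕ) : ℤ) * (m - j) + (-((k : ℤ) + 1)))).div
      (ff_tendsto q hq (((p + 1 : ℕ) : ℤ) * (j : ℤ) + ((k : ℤ) + 1))) hb
    suffices hval : (-1 : ℂ) ^ (m + 1) = ff (((p + 1 : ℕ) : ℤ) * (m - j) + (-((k : ℤ) + 1))) q /
        ff (((p + 1 : ℕ) : ℤ) * (j : ℤ) + ((k : ℤ) + 1)) q by
      rw [hval]
      exact h
    rw [ff_shift q hq _ hql, ff_shift q hq _ hql, e3, zpow_sub₀ h1, zpow_add_one₀ h1]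
    rw [eq_div_iff (mul_ne_zero hj hk'), div_eq_mul_inv, hinv]
    ring
  have C := A.mul (tendsto_finsetProd _ B)
  have e : ((-1 : ℂ)) ^ (m - j - (j + 1)) = (-1) ^ (m + 1) := by
    rw [show m - j - (j + 1) = m + 1 - j - j - 1 - 1 by ring, zpow_sub_one₀ h1, zpow_sub_one₀ h1,
      zpow_sub₀ h1, zpow_sub₀ h1, div_div, hjj]
    norm_num
  have e' : ∏ _k ∈ Finset.range p, ((-1 : ℂ) ^ (m + 1)) = 1 := by
    obtain ⟨t, rfl⟩ := hp
    rw [Finset.prod_const, Finset.card_range, pow_add, ← mul_pow, ← mul_zpow]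
    norm_num
  rw [e, e', mul_one] at C
  push_cast at C
  refine C.congr fun v => ?_
  rw [Finset.prod_div_distrib, Finset.prod_div_distrib, Finset.prod_range_succ',
    Finset.prod_range_succ (fun k => ff ((((p + 1) * j + k : ℕ) : ℤ) + 1) v),
    div_mul_div_comm, mul_comm (ff _ v) (∏ x ∈ _, _), mul_comm (ff _ v) (∏ x ∈ _, _)]
  congr 2
  congr 1; push_cast; ring

lemma main_lim (q : ℂ) (hq : q ≠ 0) (p : ℕ) (hp : Even p) (hql : q ^ (p + 1) = -1)
    (hne : ∀ k < p, ff ((k : ℤ) + 1) q ≠ 0) (m : ℤ) (r : ℕ) :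
    Tendsto (gaussBinom (((p + 1 : ℕ) : ℤ) * m) ((p + 1) * r)) (nhdsWithin q {q}ᶜ)
      (nhds ((-1 : ℂ) ^ ((m + 1) * r) * genBinom m r)) := by
  induction r with
  | zero =>
    have : gaussBinom (((p + 1 : ℕ) : ℤ) * m) ((p + 1) * 0) = fun _ => 1 := by
      funext v; simp [gaussBinom]
    rw [this]
    simp [genBinom]
  | succ r ih =>
    have h := ih.mul (block q hq p hp hql hne m r)
    have e : (-1 : ℂ) ^ ((m + 1) * r) * genBinom m r * ((-1) ^ (m + 1) * ((m - r) / (r + 1)))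
        = (-1 : ℂ) ^ ((m + 1) * ((r + 1 : ℕ) : ℤ)) * genBinom m (r + 1) := by
      have hr : (r : ℂ) + 1 ≠ 0 := by exact_mod_cast Nat.succ_ne_zero r
      have hf : (r.factorial : ℂ) ≠ 0 := by exact_mod_cast Nat.factorial_ne_zero r
      unfold genBinom
      rw [Finset.prod_range_succ, Nat.factorial_succ]
      push_cast
      rw [mul_add (m + 1), mul_one, zpow_add₀ (by norm_num : (-1 : ℂ) ≠ 0) ((m + 1) * r)]
      field_simp
    rw [e] at h
    refine h.congr fun v => ?_
    rw [mul_add_one]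
    unfold gaussBinom
    rw [Finset.prod_range_add _ ((p + 1) * r)]
    rfl

theorem stmt0 (l : ℕ) (hl : Odd l) (hl3 : 3 ≤ l) (m₁ : ℤ) (r₁ : ℕ) :
    Tendsto (gaussBinom (l * m₁) (l * r₁))
      (nhdsWithin (Complex.exp (Real.pi * Complex.I / l)) (badSet (l * r₁))ᶜ)
      (nhds ((-1 : ℂ) ^ ((m₁ + 1) * r₁) * genBinom m₁ r₁)) := by
  obtain ⟨t, rfl⟩ := hl
  set q := Complex.exp (Real.pi * Complex.I / ((2 * t + 1 : ℕ) : ℂ)) with hqdef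
  have hq : q ≠ 0 := Complex.exp_ne_zero _
  have hlC : ((2 * t + 1 : ℕ) : ℂ) ≠ 0 := by exact_mod_cast Nat.succ_ne_zero (2 * t)
  have hql : q ^ (2 * t + 1) = -1 := by
    rw [hqdef, ← Complex.exp_nat_mul, mul_div_cancel₀ _ hlC, Complex.exp_pi_mul_I]
  have hprim : IsPrimitiveRoot (q ^ 2) (2 * t + 1) := by
    have := Complex.isPrimitiveRoot_exp (2 * t + 1) (by omega)
    convert this using 1
    rw [hqdef, ← Complex.exp_nat_mul]
    congr 1
    push_cast
    ring
  have hne : ∀ k < 2 * t, ff ((k : ℤ) + 1) q ≠ 0 := by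
    intro k hk h0
    refine hprim.pow_ne_one_of_pos_of_lt (l := k + 1) (by omega) (by omega) ?_
    unfold ff at h0
    have h1 : q ^ ((k : ℤ) + 1) = q ^ (k + 1) := by exact_mod_cast zpow_natCast q (k + 1)
    rw [zpow_neg, h1, sub_eq_zero] at h0
    rw [← pow_mul, mul_comm, pow_mul, sq]
    nth_rewrite 2 [h0]
    exact mul_inv_cancel₀ (pow_ne_zero _ hq)
  have main := main_lim q hq (2 * t) (even_two_mul t) hql hne m₁ r₁
  rcases Nat.eq_zero_or_pos r₁ with rfl | hr
  · have : gaussBinom (((2 * t + 1 : ℕ) : ℤ) * m₁) ((2 * t + 1) * 0) = fun _ => 1 := by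
      funext v; simp [gaussBinom]
    rw [this]
    simpa [genBinom] using tendsto_const_nhds
  · refine main.mono_left (nhdsWithin_mono _ ?_)
    intro v hv hvq
    apply hv
    right
    refine ⟨2 * t + 1, by omega, Nat.le_mul_of_pos_right _ hr, ?_⟩
    rw [Set.mem_singleton_iff.1 hvq, mul_comm, pow_mul, hql]
    norm_num
end

section
/- Let l ≥ 3 be an odd integer and q = e^{iπ/l} ∈ ℂ. Let m = l m₁ + m₀ with m₁ ∈ ℤ and 0 ≤ m₀ ≤ l−1, and let r = l r₁ + r₀ with r₁ ∈ ℕ and 0 ≤ r₀ ≤ l−1. Then the limit of B_{m,r}(v) as v → q, taken over v ∈ ℂ outside the finite set Z_r, exists and equals (−1)^{(m₀ r₁ − m₁ r₀) + (m₁+1) r₁} · C(m₁, r₁) · ∏_{s=1}^{r₀} (q^{m₀−s+1} − q^{−(m₀−s+1)})/(q^{s} − q^{−s}), where C(m₁, r₁) := m₁(m₁−1)⋯(m₁−r₁+1)/r₁! is the generalized binomial coefficient of the integer m₁ (note that q^{s} ≠ q^{−s} for 1 ≤ s ≤ l−1, so the last product is well defined). -/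
open Filter

noncomputable def NN (k : ℤ) (v : ℂ) : ℂ := v ^ k - v ^ (-k)

noncomputable def GG (l : ℕ) (q : ℂ) (k : ℤ) : ℂ :=
  if (l : ℤ) ∣ k then ((k / l : ℤ) : ℂ) * (-1) ^ (k / l - 1 : ℤ) else NN k q

noncomputable def gg (l : ℕ) (k : ℤ) (v : ℂ) : ℂ :=
  if (l : ℤ) ∣ k then NN k v / NN l v else NN k v

lemma NN_tendsto (q : ℂ) (hq : q ≠ 0) (F : Filter ℂ) (hF : F ≤ nhds q) (k : ℤ) :
    Tendsto (NN k) F (nhds (NN k q)) := by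
  refine Tendsto.mono_left ?_ hF
  exact ((continuousAt_zpow₀ q k (Or.inl hq)).sub (continuousAt_zpow₀ q (-k) (Or.inl hq)))

lemma NN_neg (k : ℤ) (v : ℂ) : NN (-k) v = - NN k v := by
  unfold NN; rw [neg_neg]; ring

lemma NN_shift (l : ℕ) (q : ℂ) (hq : q ≠ 0) (hql : q ^ l = -1) (a k : ℤ) :
    NN (l * a + k) q = (-1) ^ a * NN k q := by
  unfold NN
  have h1 : q ^ ((l : ℤ) * a) = (-1) ^ a := by
    rw [zpow_mul, zpow_natCast, hql]
  rw [neg_add, zpow_add₀ hq, zpow_add₀ hq, h1, zpow_neg q (_ * _), h1]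
  have : ((-1 : ℂ) ^ a)⁻¹ = (-1) ^ a := by
    rcases Int.even_or_odd a with h | h
    · simp [h.neg_one_zpow]
    · simp [h.neg_one_zpow]
  rw [this]; ring

lemma U_tendsto (F : Filter ℂ) (w : ℂ → ℂ) (hw : Tendsto w F (nhds (-1)))
    (h : ∀ᶠ v in F, NN 1 (w v) ≠ 0) (a : ℤ) :
    Tendsto (fun v => NN a (w v) / NN 1 (w v)) F (nhds ((a : ℂ) * (-1) ^ (a - 1))) := by
  have hz : ∀ n : ℤ, Tendsto (fun v => w v ^ n) F (nhds ((-1) ^ n)) := fun n =>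
    (continuousAt_zpow₀ (-1 : ℂ) n (Or.inl (by norm_num))).tendsto.comp hw
  have h0 : ∀ᶠ v in F, w v ≠ 0 := by
    filter_upwards [h] with v hv h0
    apply hv; simp [NN, h0]
  have hm : (-1 : ℂ) ≠ 0 := by norm_num
  induction a using Int.induction_on with
  | zero => simpa [NN] using tendsto_const_nhds
  | succ n ih =>
    have := (hw.mul ih).add (hz (-n))
    refine Tendsto.congr' ?_ (this.trans_eq ?_)
    · filter_upwards [h, h0] with v hv h0
      rw [eq_div_iff hv, add_mul, mul_assoc, div_mul_cancel₀ _ hv]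
      simp only [NN, neg_add, zpow_add₀ h0, zpow_one, zpow_neg]
      field_simp
      ring
    · congr 1
      rcases Int.even_or_odd (n : ℤ) with e | e
      · rw [e.neg.neg_one_zpow, (e.sub_odd odd_one).neg_one_zpow,
          show (n : ℤ) + 1 - 1 = n by ring, e.neg_one_zpow]
        push_cast; ring
      · rw [e.neg.neg_one_zpow, (e.sub_odd odd_one).neg_one_zpow,
          show (n : ℤ) + 1 - 1 = n by ring, e.neg_one_zpow]
        push_cast; ring
  | pred n ih =>
    have := ((hz (-1)).mul ih).sub (hz n)
    refine Tendsto.congr' ?_ (this.trans_eq ?_)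
    · filter_upwards [h, h0] with v hv h0
      rw [eq_div_iff hv, sub_mul, mul_assoc, div_mul_cancel₀ _ hv]
      simp only [NN, neg_sub, neg_neg, sub_eq_add_neg, neg_add, zpow_add₀ h0, zpow_one, zpow_neg]
      field_simp
      ring
    · congr 1
      rcases Int.even_or_odd (n : ℤ) with e | e
      · rw [e.neg_one_zpow, (e.neg.sub_odd odd_one).neg_one_zpow,
          ((e.neg.sub_odd odd_one).sub_odd odd_one).neg_one_zpow]
        push_cast; norm_num
      · rw [e.neg_one_zpow, (e.neg.sub_odd odd_one).neg_one_zpow,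
          ((e.neg.sub_odd odd_one).sub_odd odd_one).neg_one_zpow]
        push_cast; norm_num; ring

lemma gg_tendsto (l : ℕ) (q : ℂ) (hq : q ≠ 0) (hql : q ^ l = -1) (F : Filter ℂ)
    (hF : F ≤ nhds q) (hD : ∀ᶠ v in F, NN l v ≠ 0) (k : ℤ) :
    Tendsto (gg l k) F (nhds (GG l q k)) := by
  unfold gg GG
  split_ifs with h
  · obtain ⟨a, rfl⟩ := h
    have hl : (l : ℤ) ≠ 0 := by
      rintro h0
      have : l = 0 := by exact_mod_cast h0
      subst this; norm_num at hql
    rw [Int.mul_ediv_cancel_left _ hl]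
    have hw : Tendsto (fun v : ℂ => v ^ l) F (nhds (-1)) := by
      rw [← hql]
      exact ((continuous_pow l).tendsto q).mono_left hF
    have e : ∀ (a : ℤ) (v : ℂ), NN a (v ^ l) = NN (l * a) v := by
      intro a v
      unfold NN
      rw [← mul_neg, zpow_mul, zpow_mul, zpow_natCast]
    have := U_tendsto F _ hw (by simpa [e] using hD) a
    simpa [e] using this
  · exact NN_tendsto q hq F hF k

lemma GG_mul (l : ℕ) (hl : l ≠ 0) (q : ℂ) (a : ℤ) :
    GG l q (l * a) = (a : ℂ) * (-1) ^ (a - 1) := by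
  unfold GG
  rw [if_pos (dvd_mul_right _ _), Int.mul_ediv_cancel_left _ (by exact_mod_cast hl)]

lemma GG_ndvd (l : ℕ) (q : ℂ) (hq : q ≠ 0) (hql : q ^ l = -1) (a k : ℤ) (h : ¬ (l : ℤ) ∣ k) :
    GG l q (l * a + k) = (-1) ^ a * NN k q := by
  unfold GG
  rw [if_neg (by rwa [Int.dvd_add_right (dvd_mul_right _ _)]), NN_shift l q hq hql]

/-- number of multiples -/
lemma prod_NN (l : ℕ) (v : ℂ) (hD : NN l v ≠ 0) (f : ℕ → ℤ) (j : ℕ) (hj : j < l)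
    (hf : ∀ i < l, ((l : ℤ) ∣ f i ↔ i = j)) :
    ∏ i ∈ Finset.range l, NN (f i) v = NN l v * ∏ i ∈ Finset.range l, gg l (f i) v := by
  have h1 : ∀ i ∈ Finset.range l, NN (f i) v = (if i = j then NN l v else 1) * gg l (f i) v := by
    intro i hi
    have := hf i (Finset.mem_range.1 hi)
    unfold gg
    by_cases h : i = j
    · rw [if_pos h, if_pos (this.2 h), mul_div_cancel₀ _ hD]
    · rw [if_neg h, if_neg (fun h' => h (this.1 h')), one_mul]
  rw [Finset.prod_congr rfl h1, Finset.prod_mul_distrib, Finset.prod_ite_eq',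
    if_pos (Finset.mem_range.2 hj)]

lemma ndvd_small (l i : ℕ) (h0 : 0 < i) (h : i < l) : ¬ (l : ℤ) ∣ i := by
  intro h'
  have := Nat.le_of_dvd h0 (by exact_mod_cast h')
  omega

lemma prod_den (l : ℕ) (hl : Odd l) (q : ℂ) (hq : q ≠ 0) (hql : q ^ l = -1) (k : ℤ) :
    ∏ i ∈ Finset.range l, GG l q (l * k + i + 1) =
      GG l q (l * (k + 1)) * ∏ i ∈ Finset.range (l - 1), NN (i + 1) q := by
  obtain ⟨n, hn⟩ : ∃ n, l = n + 1 := ⟨l - 1, by have := hl.pos; omega⟩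
  have hne : Even n := by
    subst hn; rw [Nat.odd_add_one] at hl; simpa using hl
  have h1 : Finset.range l = Finset.range (n + 1) := by rw [hn]
  have h2 : l - 1 = n := by omega
  rw [h1, h2, Finset.prod_range_succ, mul_comm]
  congr 1
  · congr 1; rw [hn]; push_cast; ring
  · have : ∀ i ∈ Finset.range n, GG l q (l * k + i + 1) = (-1) ^ k * NN (i + 1) q := by
      intro i hi
      rw [Finset.mem_range] at hi
      rw [add_assoc]
      apply GG_ndvd l q hq hql
      have := ndvd_small l (i + 1) (by omega) (by omega)
      exact_mod_cast this
    rw [Finset.prod_congr rfl this, Finset.prod_mul_distrib, Finset.prod_const, Finset.card_range,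
      ← zpow_natCast, ← zpow_mul, (Even.mul_left (by exact_mod_cast hne) k).neg_one_zpow, one_mul]

lemma prod_num (l : ℕ) (hl : Odd l) (q : ℂ) (hq : q ≠ 0) (hql : q ^ l = -1)
    (hN : ∀ k : ℤ, ¬ (l : ℤ) ∣ k → NN k q ≠ 0) (a : ℤ) (j : ℕ) (hj : j < l) :
    ∏ i ∈ Finset.range l, GG l q (l * a + j - i) =
      (-1) ^ j * GG l q (l * a) * ∏ i ∈ Finset.range (l - 1), NN (i + 1) q := by
  obtain ⟨n, hn⟩ : ∃ n, l = n + 1 := ⟨l - 1, by have := hl.pos; omega⟩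
  have hne : Even n := by
    subst hn; rw [Nat.odd_add_one] at hl; simpa using hl
  have h1 : Finset.range l = Finset.range (n + 1) := by rw [hn]
  have h2 : l - 1 = n := by omega
  induction j with
  | zero =>
    rw [h1, h2, Finset.prod_range_succ', mul_comm]
    congr 1
    · simp
    · have : ∀ i ∈ Finset.range n, GG l q (l * a + (0 : ℕ) - (i + 1 : ℕ)) =
          (-1) ^ (a + 1) * NN (i + 1) q := by
        intro i hi
        rw [Finset.mem_range] at hi
        rw [show (l * a + (0 : ℕ) - (i + 1 : ℕ) : ℤ) = l * a + (-(i + 1 : ℕ)) by push_cast; ring]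
        rw [GG_ndvd l q hq hql, NN_neg, zpow_add₀ (by norm_num)]
        · push_cast; norm_num
        · rw [dvd_neg]
          exact ndvd_small l (i + 1) (by omega) (by omega)
      rw [Finset.prod_congr rfl this, Finset.prod_mul_distrib, Finset.prod_const,
        Finset.card_range, ← zpow_natCast, ← zpow_mul,
        (Even.mul_left (by exact_mod_cast hne) _).neg_one_zpow, one_mul]
  | succ j ih =>
    have ih := ih (by omega)
    have hnd := ndvd_small l (j + 1) (by omega) hj
    have e1 : GG l q (l * a + (j + 1 : ℕ)) = (-1) ^ a * NN (j + 1 : ℕ) q :=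
      GG_ndvd l q hq hql _ _ hnd
    have e2 : GG l q (l * (a - 1) + (j + 1 : ℕ)) = (-1) ^ (a - 1) * NN (j + 1 : ℕ) q :=
      GG_ndvd l q hq hql _ _ hnd
    have e3 : GG l q (l * a + (j + 1 : ℕ)) = - GG l q (l * (a - 1) + (j + 1 : ℕ)) := by
      rw [e1, e2, zpow_sub₀ (by norm_num), zpow_one]; ring
    have e4 : GG l q (l * (a - 1) + (j + 1 : ℕ)) ≠ 0 := by
      rw [e2]; exact mul_ne_zero (zpow_ne_zero _ (by norm_num)) (hN _ hnd)
    have key : (∏ i ∈ Finset.range l, GG l q (l * a + (j + 1 : ℕ) - i)) *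
        GG l q (l * (a - 1) + (j + 1 : ℕ)) = GG l q (l * a + (j + 1 : ℕ)) *
        ∏ i ∈ Finset.range l, GG l q (l * a + j - i) := by
      have A := Finset.prod_range_succ (fun i : ℕ => GG l q (l * a + (j + 1 : ℕ) - i)) l
      have B := Finset.prod_range_succ' (fun i : ℕ => GG l q (l * a + (j + 1 : ℕ) - i)) l
      rw [A] at B
      have e5 : (l * (a - 1) + (j + 1 : ℕ) : ℤ) = l * a + (j + 1 : ℕ) - l := by ring
      rw [e5, B, mul_comm]
      congr 1
      · simp
      · apply Finset.prod_congr rfl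
        intro i _
        congr 1; push_cast; ring
    apply mul_right_cancel₀ e4
    rw [key, ih, e3]; ring

lemma block_tendsto (l : ℕ) (hl : Odd l) (q : ℂ) (hq : q ≠ 0) (hql : q ^ l = -1)
    (hN : ∀ k : ℤ, ¬ (l : ℤ) ∣ k → NN k q ≠ 0) (F : Filter ℂ)
    (hF : F ≤ nhds q) (hD : ∀ᶠ v in F, NN l v ≠ 0) (a : ℤ) (j : ℕ) (hj : j < l) (k : ℕ) :
    Tendsto (fun v => ∏ i ∈ Finset.range l, NN (l * a + j - i) v / NN (l * k + i + 1) v) F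
      (nhds ((-1) ^ (j + a + k + 1) * ((a : ℂ) / (k + 1)))) := by
  have hl0 : l ≠ 0 := by have := hl.pos; omega
  have hC : ∏ i ∈ Finset.range (l - 1), NN (i + 1) q ≠ 0 := by
    rw [Finset.prod_ne_zero_iff]
    intro i hi
    rw [Finset.mem_range] at hi
    have := hN _ (ndvd_small l (i + 1) (by omega) (by omega))
    exact_mod_cast this
  have hk : (k : ℂ) + 1 ≠ 0 := by exact_mod_cast Nat.succ_ne_zero k
  have hden : ∏ i ∈ Finset.range l, GG l q (l * k + i + 1) ≠ 0 := by
    rw [prod_den l hl q hq hql, GG_mul l hl0]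
    refine mul_ne_zero (mul_ne_zero ?_ (zpow_ne_zero _ (by norm_num))) hC
    push_cast; exact hk
  have T := Tendsto.div
    (tendsto_finsetProd (Finset.range l)
      (fun i _ => gg_tendsto l q hq hql F hF hD (l * a + j - i)))
    (tendsto_finsetProd (Finset.range l)
      (fun i _ => gg_tendsto l q hq hql F hF hD (l * k + i + 1))) hden
  refine Tendsto.congr' ?_ (T.trans_eq ?_)
  · filter_upwards [hD] with v hv
    rw [Finset.prod_div_distrib,
      prod_NN l v hv (fun i => l * a + j - i) j hj,
      prod_NN l v hv (fun i => l * k + i + 1) (l - 1) (by omega),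
      mul_div_mul_left _ _ hv]
    · rfl
    · intro i hi
      rw [add_assoc, Int.dvd_add_right (dvd_mul_right _ _)]
      constructor
      · intro h
        by_contra hne
        exact ndvd_small l (i + 1) (by omega) (by omega) (by exact_mod_cast h)
      · rintro rfl
        rw [Nat.cast_sub (by omega)]; simp
    · intro i hi
      rw [add_sub_assoc, Int.dvd_add_right (dvd_mul_right _ _)]
      constructor
      · intro h
        have := Int.eq_zero_of_abs_lt_dvd h (by rw [abs_lt]; omega)
        omega
      · rintro rfl; simp
  · congr 1
    rw [prod_den l hl q hq hql, prod_num l hl q hq hql hN a j hj, mul_div_mul_right _ _ hC,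
      GG_mul l hl0, GG_mul l hl0]
    push_cast
    have hs : (-1 : ℂ) ≠ 0 := by norm_num
    have e : ((-1 : ℂ) ^ k)⁻¹ = (-1) ^ k := by
      rw [← inv_pow]; norm_num
    rw [show (k : ℤ) + 1 - 1 = k by ring, zpow_natCast, zpow_sub₀ hs, zpow_add₀ hs, zpow_add₀ hs,
      zpow_add₀ hs,
      zpow_natCast, zpow_natCast, zpow_one, div_eq_mul_inv, mul_inv, e]
    field_simp

lemma q_facts (l : ℕ) (hl : 3 ≤ l) (q : ℂ) (hqd : q = Complex.exp (Real.pi * Complex.I / l)) :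
    q ≠ 0 ∧ q ^ l = -1 ∧ ∀ k : ℤ, ¬ (l : ℤ) ∣ k → NN k q ≠ 0 := by
  have hl0 : (l : ℂ) ≠ 0 := by
    have : l ≠ 0 := by omega
    exact_mod_cast this
  have hq : q ≠ 0 := by rw [hqd]; exact Complex.exp_ne_zero _
  refine ⟨hq, ?_, ?_⟩
  · rw [hqd, ← Complex.exp_nat_mul, mul_div_cancel₀ _ hl0, Complex.exp_pi_mul_I]
  · intro k hk h
    unfold NN at h
    have h2 : q ^ (2 * k) = 1 := by
      rw [two_mul, zpow_add₀ hq]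
      nth_rewrite 1 [sub_eq_zero.1 h]
      rw [← zpow_add₀ hq]; simp
    rw [hqd, ← Complex.exp_int_mul, Complex.exp_eq_one_iff] at h2
    obtain ⟨n, hn⟩ := h2
    apply hk
    refine ⟨n, ?_⟩
    have hpi : (Real.pi : ℂ) ≠ 0 := by exact_mod_cast Real.pi_ne_zero
    have hI := Complex.I_ne_zero
    field_simp at hn
    push_cast at hn
    have h3 : (2 * Real.pi * Complex.I : ℂ) * k = (2 * Real.pi * Complex.I) * (l * n) := by
      linear_combination (Real.pi * Complex.I) * hn
    have := mul_left_cancel₀ (by simp [hpi, hI]) h3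
    exact_mod_cast this

lemma prod_blocks (f : ℕ → ℂ) (l n : ℕ) :
    ∏ i ∈ Finset.range (l * n), f i =
      ∏ k ∈ Finset.range n, ∏ i ∈ Finset.range l, f (l * k + i) := by
  induction n with
  | zero => simp
  | succ n ih => rw [Nat.mul_succ, Finset.prod_range_add, ih, Finset.prod_range_succ]

lemma neg_one_zpow_congr (a b : ℤ) (h : Even (a - b)) : (-1 : ℂ) ^ a = (-1) ^ b := by
  have : a = (a - b) + b := by ring
  rw [this, zpow_add₀ (by norm_num), h.neg_one_zpow, one_mul]

theorem stmt1 (l : ℕ) (hl : Odd l) (hl3 : 3 ≤ l)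
    (m m₀ m₁ : ℤ) (hm : m = l * m₁ + m₀) (hm₀ : 0 ≤ m₀) (hm₀' : m₀ ≤ (l : ℤ) - 1)
    (r r₀ r₁ : ℕ) (hr : r = l * r₁ + r₀) (hr₀ : r₀ ≤ l - 1) :
    Tendsto (gaussBinom m r)
      (nhdsWithin (Complex.exp (Real.pi * Complex.I / l)) (badSet r)ᶜ)
      (nhds ((-1 : ℂ) ^ (m₀ * r₁ - m₁ * r₀ + (m₁ + 1) * r₁) * genBinom m₁ r₁ *
        gaussBinom m₀ r₀ (Complex.exp (Real.pi * Complex.I / l)))) := by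
  obtain ⟨q, hqd⟩ : ∃ q, q = Complex.exp (Real.pi * Complex.I / l) := ⟨_, rfl⟩
  rw [← hqd]
  obtain ⟨hq, hql, hN⟩ := q_facts l hl3 q hqd
  obtain ⟨j, rfl⟩ := Int.eq_ofNat_of_zero_le hm₀
  have hj : j < l := by omega
  set F := nhdsWithin q (badSet r)ᶜ with hFd
  have hF : F ≤ nhds q := nhdsWithin_le_nhds
  have hs : (-1 : ℂ) ≠ 0 := by norm_num
  have hD : 0 < r₁ → ∀ᶠ v in F, NN l v ≠ 0 := by
    intro h1
    filter_upwards [self_mem_nhdsWithin] with v hv h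
    have hlr : l ≤ r := by rw [hr]; nlinarith
    apply hv
    by_cases h0 : v = 0
    · left; exact h0
    · right
      refine ⟨l, by omega, hlr, ?_⟩
      unfold NN at h
      rw [two_mul, pow_add]
      rw [sub_eq_zero, zpow_neg, zpow_natCast] at h
      nth_rewrite 1 [h]
      exact inv_mul_cancel₀ (pow_ne_zero _ h0)
  have hB : Tendsto (fun v => ∏ k ∈ Finset.range r₁, ∏ i ∈ Finset.range l,
      NN (l * (m₁ - k) + j - i) v / NN (l * k + i + 1) v) F
      (nhds ((-1 : ℂ) ^ ((j + m₁ + 1) * r₁) * genBinom m₁ r₁)) := by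
    have T := tendsto_finsetProd (f := fun (k : ℕ) (v : ℂ) => ∏ i ∈ Finset.range l,
      NN (l * (m₁ - k) + j - i) v / NN (l * k + i + 1) v) (x := F) (Finset.range r₁)
      (fun k hk => block_tendsto l hl q hq hql hN F hF
        (hD (by have := Finset.mem_range.1 hk; omega)) (m₁ - k) j hj k)
    refine T.trans_eq ?_
    congr 1
    rw [Finset.prod_mul_distrib, Finset.prod_div_distrib]
    congr 1
    · rw [zpow_mul, zpow_natCast, ← Finset.card_range r₁, ← Finset.prod_const, Finset.card_range]
      apply Finset.prod_congr rfl
      intro k _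
      apply neg_one_zpow_congr
      exact ⟨0, by ring⟩
    · unfold genBinom
      rw [← Finset.prod_range_add_one_eq_factorial]
      push_cast
      rfl
  have hR : Tendsto (fun v => ∏ i ∈ Finset.range r₀,
      NN (l * (m₁ - r₁) + (j - i)) v / NN (l * r₁ + (i + 1)) v) F
      (nhds ((-1 : ℂ) ^ (m₁ * r₀) * gaussBinom j r₀ q)) := by
    have hne : ∀ i ∈ Finset.range r₀, NN (i + 1) q ≠ 0 := by
      intro i hi
      rw [Finset.mem_range] at hi
      have := hN _ (ndvd_small l (i + 1) (by omega) (by omega))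
      exact_mod_cast this
    have T := tendsto_finsetProd (f := fun (i : ℕ) (v : ℂ) =>
      NN (l * (m₁ - r₁) + (j - i)) v / NN (l * r₁ + (i + 1)) v) (x := F) (Finset.range r₀)
      (fun i hi => (NN_tendsto q hq F hF _).div (NN_tendsto q hq F hF _) (by
        rw [NN_shift l q hq hql]
        exact mul_ne_zero (zpow_ne_zero _ hs) (hne i hi)))
    refine T.trans_eq ?_
    congr 1
    unfold gaussBinom
    rw [zpow_mul, zpow_natCast]
    nth_rewrite 2 [← Finset.card_range r₀]
    rw [← Finset.prod_const, ← Finset.prod_mul_distrib]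
    apply Finset.prod_congr rfl
    intro i _
    rw [NN_shift l q hq hql, NN_shift l q hq hql, mul_div_mul_comm, ← zpow_sub₀ hs]
    rw [neg_one_zpow_congr (m₁ - r₁ - r₁) m₁ ⟨-r₁, by ring⟩]
    rfl
  refine ((hB.mul hR).congr ?_).trans_eq ?_
  · intro v
    unfold gaussBinom
    rw [hr, Finset.prod_range_add, prod_blocks]
    congr 1
    · apply Finset.prod_congr rfl
      intro k _
      apply Finset.prod_congr rfl
      intro i _
      change _ = NN _ v / NN _ v
      congr 2 <;> (rw [hm] <;> push_cast <;> ring)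
    · apply Finset.prod_congr rfl
      intro i _
      change _ = NN _ v / NN _ v
      congr 2 <;> (rw [hm] <;> push_cast <;> ring)
  · congr 1
    rw [mul_mul_mul_comm, ← zpow_add₀ hs, ← mul_assoc]
    congr 2
    apply neg_one_zpow_congr
    exact ⟨m₁ * r₀, by ring⟩
end

section
/- Let l ≥ 3 be an odd integer and q = e^{iπ/l} ∈ ℂ. Let m ∈ ℤ and write m = l m₁ + m₀ with m₀ = m mod l ∈ {0, …, l−1} and m₁ = (m − m₀)/l ∈ ℤ. Then the limit of B_{m,l}(v) as v → q, taken over v ∈ ℂ outside the finite set Z_l, exists and equals (−1)^{m+1} · m₁. -/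
open Filter

/-- v^k - v^{-k}. -/
noncomputable def cc (v : ℂ) (k : ℤ) : ℂ := v ^ k - v ^ (-k)

lemma cc_neg (v : ℂ) (k : ℤ) : cc v (-k) = - cc v k := by simp [cc]

lemma cc_shift (v : ℂ) (hv : v ≠ 0) (l : ℕ) (h : v ^ l = -1) (n k : ℤ) :
    cc v (l * n + k) = (-1) ^ n * cc v k := by
  have e : ∀ n : ℤ, v ^ ((l : ℤ) * n) = (-1) ^ n := by
    intro n; rw [zpow_mul, zpow_natCast, h]
  have e2 : ((-1 : ℂ)) ^ (-n) = (-1) ^ n := by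
    rw [zpow_neg, ← inv_zpow]; norm_num
  have e3 : -((l : ℤ) * n + k) = l * (-n) + (-k) := by ring
  unfold cc
  rw [e3, zpow_add₀ hv, zpow_add₀ hv, e, e, e2]; ring

lemma cc_cont (q : ℂ) (hq : q ≠ 0) (k : ℤ) : ContinuousAt (fun v => cc v k) q :=
  (continuousAt_zpow₀ q k (Or.inl hq)).sub (continuousAt_zpow₀ q (-k) (Or.inl hq))

lemma cc_deriv (q : ℂ) (hq : q ≠ 0) (k : ℤ) :
    HasDerivAt (fun v => cc v k) (k * q ^ (k-1) - (-k : ℤ) * q ^ (-k-1)) q :=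
  (hasDerivAt_zpow k q (Or.inl hq)).sub (hasDerivAt_zpow (-k) q (Or.inl hq))

lemma gauss_split (a b : ℕ) (m : ℤ) (v : ℂ) :
    gaussBinom m (a + b + 1) v =
      (cc v (m - a) / cc v ((a + b + 1 : ℕ) : ℤ)) *
      ((∏ i ∈ Finset.range a, cc v (m - i)) / (∏ i ∈ Finset.range a, cc v (i + 1))) *
      ((∏ j ∈ Finset.range b, cc v (m - (a + 1 + j))) /
        (∏ j ∈ Finset.range b, cc v (a + j + 1))) := by
  have h1 : gaussBinom m (a + b + 1) v =
      (∏ i ∈ Finset.range (a + 1 + b), cc v (m - i)) /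
        (∏ i ∈ Finset.range (a + b + 1), cc v (i + 1)) := by
    rw [show a + 1 + b = a + b + 1 by ring, ← Finset.prod_div_distrib]; rfl
  rw [h1, Finset.prod_range_add, Finset.prod_range_succ, Finset.prod_range_succ,
    Finset.prod_range_add]
  push_cast
  simp only [div_eq_mul_inv, mul_inv]
  ring

theorem stmt3 (l : ℕ) (hl : Odd l) (hl3 : 3 ≤ l)
    (m m₀ m₁ : ℤ) (hm : m = l * m₁ + m₀) (hm₀ : 0 ≤ m₀) (hm₀' : m₀ ≤ (l : ℤ) - 1) :
    Tendsto (gaussBinom m l)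
      (nhdsWithin (Complex.exp (Real.pi * Complex.I / l)) (badSet l)ᶜ)
      (nhds ((-1 : ℂ) ^ (m + 1) * (m₁ : ℂ))) := by
  have hl0 : (l : ℂ) ≠ 0 := by exact_mod_cast (by omega : l ≠ 0)
  have hprim : IsPrimitiveRoot (Complex.exp (Real.pi * Complex.I / l)) (2 * l) := by
    have := Complex.isPrimitiveRoot_exp (2 * l) (by omega)
    convert this using 2
    push_cast
    field_simp
  have hql : (Complex.exp (Real.pi * Complex.I / l)) ^ l = -1 := by
    rw [← Complex.exp_nat_mul, mul_div_cancel₀ _ hl0, Complex.exp_pi_mul_I]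
  have hq : Complex.exp (Real.pi * Complex.I / l) ≠ 0 := Complex.exp_ne_zero _
  generalize Complex.exp (Real.pi * Complex.I / l) = q at *
  have hle : nhdsWithin q (badSet l)ᶜ ≤ nhdsWithin q {q}ᶜ := by
    apply nhdsWithin_mono
    intro v hv hvq
    rw [Set.mem_singleton_iff] at hvq
    subst hvq
    exact hv (Or.inr ⟨l, by omega, le_rfl, hprim.pow_eq_one⟩)
  have hne : ∀ s : ℕ, 1 ≤ s → s < l → cc q s ≠ 0 := by
    intro s h1 h2 h
    unfold cc at h
    have h3 : q ^ (2 * s) = 1 := by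
      rw [sub_eq_zero, zpow_neg, zpow_natCast] at h
      rw [two_mul, pow_add]
      nth_rw 1 [h]
      exact inv_mul_cancel₀ (pow_ne_zero _ hq)
    have := Nat.le_of_dvd (by omega) (hprim.dvd_of_pow_eq_one _ h3)
    omega
  obtain ⟨a, rfl⟩ := Int.eq_ofNat_of_zero_le hm₀
  obtain ⟨b, rfl⟩ : ∃ b, l = a + b + 1 := ⟨l - 1 - a, by omega⟩
  have hsh := cc_shift q hq _ hql
  have hε : ((-1 : ℂ) ^ m₁) * (-1) ^ m₁ = 1 := by
    rw [← mul_zpow]; norm_num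
  -- the singular ratio
  have R : Tendsto (fun v => cc v (m - a) / cc v ((a + b + 1 : ℕ) : ℤ))
      (nhdsWithin q (badSet (a + b + 1))ᶜ) (nhds (-(-1) ^ m₁ * m₁)) := by
    refine Tendsto.mono_left ?_ hle
    have z : ∀ n : ℤ, q ^ (((a + b + 1 : ℕ) : ℤ) * n) = (-1) ^ n := by
      intro n; rw [zpow_mul, zpow_natCast, hql]
    have em : m - a = ((a + b + 1 : ℕ) : ℤ) * m₁ := by rw [hm]; ring
    have e2 : ((-1 : ℂ)) ^ (-m₁) = (-1) ^ m₁ := by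
      rw [zpow_neg, ← inv_zpow]; norm_num
    have d1 := cc_deriv q hq (((a + b + 1 : ℕ) : ℤ) * m₁)
    have d2 := cc_deriv q hq ((a + b + 1 : ℕ) : ℤ)
    have f1 : cc q (((a + b + 1 : ℕ) : ℤ) * m₁) = 0 := by
      have := hsh m₁ 0
      simpa [cc] using this
    have f2 : cc q ((a + b + 1 : ℕ) : ℤ) = 0 := by
      have := hsh 1 0
      simpa [cc] using this
    have v1 : (((((a + b + 1 : ℕ) : ℤ) * m₁ : ℤ)) : ℂ) * q ^ (((a + b + 1 : ℕ) : ℤ) * m₁ - 1)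
        - ((-(((a + b + 1 : ℕ) : ℤ) * m₁) : ℤ) : ℂ) * q ^ (-(((a + b + 1 : ℕ) : ℤ) * m₁) - 1)
        = 2 * ((a + b + 1 : ℕ) : ℂ) * m₁ * (-1) ^ m₁ * q⁻¹ := by
      rw [zpow_sub_one₀ hq, zpow_sub_one₀ hq, ← mul_neg, z, z, e2]
      push_cast; ring
    have v2 : ((((a + b + 1 : ℕ) : ℤ)) : ℂ) * q ^ (((a + b + 1 : ℕ) : ℤ) - 1)
        - ((-((a + b + 1 : ℕ) : ℤ) : ℤ) : ℂ) * q ^ (-((a + b + 1 : ℕ) : ℤ) - 1)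
        = -2 * ((a + b + 1 : ℕ) : ℂ) * q⁻¹ := by
      rw [zpow_sub_one₀ hq, zpow_sub_one₀ hq, zpow_neg, zpow_natCast, hql]
      push_cast; norm_num; ring
    rw [v1] at d1
    rw [v2] at d2
    have t := (hasDerivAt_iff_tendsto_slope.1 d1).div (hasDerivAt_iff_tendsto_slope.1 d2)
      (by simp only [ne_eq, mul_eq_zero, inv_eq_zero, hq, hl0]; norm_num)
    rw [em]
    have ev : (2 * ((a + b + 1 : ℕ) : ℂ) * m₁ * (-1) ^ m₁ * q⁻¹) /
        (-2 * ((a + b + 1 : ℕ) : ℂ) * q⁻¹) = -(-1) ^ m₁ * m₁ := by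
      field_simp
    rw [ev] at t
    refine t.congr' ?_
    filter_upwards [self_mem_nhdsWithin] with v hv
    have hv' : v - q ≠ 0 := sub_ne_zero.2 hv
    simp only [Pi.div_apply, slope_def_field, f1, f2, sub_zero]
    exact div_div_div_cancel_right₀ hv' _ _
  have Q1 : (∏ i ∈ Finset.range a, cc q (i + 1)) ≠ 0 := by
    rw [Finset.prod_ne_zero_iff]
    intro i hi
    have := Finset.mem_range.1 hi
    exact_mod_cast hne (i + 1) (by omega) (by omega)
  have Q2 : (∏ j ∈ Finset.range b, cc q (a + j + 1)) ≠ 0 := by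
    rw [Finset.prod_ne_zero_iff]
    intro i hi
    have := Finset.mem_range.1 hi
    exact_mod_cast hne (a + i + 1) (by omega) (by omega)
  have P1 : (∏ i ∈ Finset.range a, cc q (m - i)) =
      ((-1) ^ m₁) ^ a * ∏ i ∈ Finset.range a, cc q (i + 1) := by
    rw [← Finset.prod_range_reflect (fun i : ℕ => cc q ((i : ℤ) + 1))]
    rw [show ((-1 : ℂ) ^ m₁) ^ a = ∏ i ∈ Finset.range a, (-1 : ℂ) ^ m₁ by simp, ← Finset.prod_mul_distrib]
    refine Finset.prod_congr rfl fun i hi => ?_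
    have := Finset.mem_range.1 hi
    rw [← hsh]
    congr 1
    rw [hm]; push_cast [show 1 ≤ a by omega, show i ≤ a - 1 by omega]; omega
  have P2 : (∏ j ∈ Finset.range b, cc q (m - (a + 1 + j))) =
      (-(-1) ^ m₁) ^ b * ∏ j ∈ Finset.range b, cc q (a + j + 1) := by
    rw [← Finset.prod_range_reflect (fun j : ℕ => cc q ((a : ℤ) + j + 1))]
    rw [show (-(-1 : ℂ) ^ m₁) ^ b = ∏ i ∈ Finset.range b, (-(-1 : ℂ) ^ m₁) by simp, ← Finset.prod_mul_distrib]
    refine Finset.prod_congr rfl fun j hj => ?_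
    have := Finset.mem_range.1 hj
    have h1 : m - (a + 1 + j) = ((a + b + 1 : ℕ) : ℤ) * m₁ + (-(1 + j)) := by rw [hm]; ring
    have h2 : ((a : ℤ) + ((b - 1 - j : ℕ) : ℤ) + 1)
        = ((a + b + 1 : ℕ) : ℤ) * 1 + (-(1 + j)) := by
      omega
    rw [h1, h2, hsh, hsh]
    simp
  have C : ∀ (n : ℕ) (f g : ℕ → ℤ), (∏ i ∈ Finset.range n, cc q (g i)) ≠ 0 →
      Tendsto (fun v => (∏ i ∈ Finset.range n, cc v (f i)) / (∏ i ∈ Finset.range n, cc v (g i)))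
        (nhdsWithin q (badSet (a + b + 1))ᶜ)
        (nhds ((∏ i ∈ Finset.range n, cc q (f i)) / (∏ i ∈ Finset.range n, cc q (g i)))) := by
    intro n f g h
    refine Tendsto.mono_left ?_ nhdsWithin_le_nhds
    exact (tendsto_finsetProd _ fun i _ => cc_cont q hq (f i)).div
      (tendsto_finsetProd _ fun i _ => cc_cont q hq (g i)) h
  have T := (R.mul (C a (fun i => m - i) (fun i => i + 1) Q1)).mul
    (C b (fun j => m - (a + 1 + j)) (fun j => a + j + 1) Q2)
  rw [P1, P2, mul_div_cancel_right₀ _ Q1, mul_div_cancel_right₀ _ Q2] at T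
  have hab : Even (a + b) := by
    rcases hl with ⟨k, hk⟩
    exact ⟨k, by omega⟩
  have key : -(-1 : ℂ) ^ m₁ * m₁ * ((-1) ^ m₁) ^ a * (-(-1) ^ m₁) ^ b = (-1) ^ (m + 1) * m₁ := by
    have h1 : ((-1 : ℂ)) ^ (m + 1) = - ((-1) ^ m₁ * (-1) ^ a) := by
      rw [hm, zpow_add_one₀ (by norm_num), zpow_add₀ (by norm_num), zpow_mul, zpow_natCast,
        hl.neg_one_pow, zpow_natCast]
      ring
    have h2 : (-1 : ℂ) ^ a = (-1) ^ b := by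
      rcases Nat.even_or_odd a with h | h
      · rw [h.neg_one_pow, ((Nat.even_add.1 hab).1 h).neg_one_pow]
      · have : Odd b := by
          rw [← Nat.not_even_iff_odd] at h ⊢
          exact fun hb => h ((Nat.even_add.1 hab).2 hb)
        rw [h.neg_one_pow, this.neg_one_pow]
    have h3 : ((-1 : ℂ) ^ m₁) ^ (a + b) = 1 := by
      rcases hab with ⟨k, hk⟩
      rw [hk, ← two_mul, pow_mul, sq, hε, one_pow]
    rw [h1, h2, neg_pow ((-1 : ℂ) ^ m₁) b]
    rw [pow_add] at h3
    linear_combination (-(-1 : ℂ) ^ m₁ * m₁ * (-1) ^ b) * h3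
  rw [key] at T
  exact T.congr fun v => (gauss_split a b m v).symm
end

section
/- Let l ≥ 3 be an odd integer, N ∈ ℕ, and x ∈ ℂ with x ∉ {0, 1, −1}. Then (x + x^{−1})^{N} = Σ_{k=0}^{N} M^{(l)}_k(N) · ch_{T(k)}(x). (For k with k ≢ N (mod 2) the multiplicity M^{(l)}_k(N) vanishes, so those terms contribute nothing.) -/
/-- `intBinom N j = binom(N, j)` for an integer `j`, with the convention that it vanishes
for `j < 0` or `j > N`. -/
def intBinom (N : ℕ) (j : ℤ) : ℤ :=
  if 0 ≤ j ∧ j ≤ (N : ℤ) then (N.choose j.toNat : ℤ) else 0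

/-- `Fcoef N k = F^{(N)}_k = binom(N,(N−k)/2) − binom(N,(N−k−2)/2)` if `k ≡ N (mod 2)`,
and `0` otherwise. -/
def Fcoef (N : ℕ) (k : ℤ) : ℤ :=
  if ((N : ℤ) - k) % 2 = 0 then
    intBinom N (((N : ℤ) - k) / 2) - intBinom N (((N : ℤ) - k - 2) / 2)
  else 0

/-- The multiplicity `M^{(l)}_k(N)` of the tilting module `T(k)` in `T(1)^{⊗N}`.
Writing `k = k₁ l + k₀` with `0 ≤ k₀ ≤ l−1`, it is `F^{(N)}_k` when `k₀ = l−1`, and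
`Σ_{j≥0} (F^{(N)}_{k+2jl} − F^{(N)}_{(k₁+2j+2)l−k₀−2})` when `0 ≤ k₀ ≤ l−2`; all terms of the
infinite sum with `j > N` vanish, so it is truncated at `j = N`. -/
def Mmult (l k N : ℕ) : ℤ :=
  if k % l = l - 1 then Fcoef N k
  else ∑ j ∈ Finset.range (N + 1),
    (Fcoef N ((k : ℤ) + 2 * j * l) -
      Fcoef N ((((k / l : ℕ) : ℤ) + 2 * (j : ℤ) + 2) * l - ((k % l : ℕ) : ℤ) - 2))

/-- The character `ch_{T(k)}(x)` of the indecomposable tilting module `T(k)`,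
where `k = k₁ l + k₀` with `0 ≤ k₀ ≤ l−1`. -/
noncomputable def chT (l k : ℕ) (x : ℂ) : ℂ :=
  if k / l = 0 then
    (x ^ (((k % l : ℕ) : ℤ) + 1) - x ^ (-(((k % l : ℕ) : ℤ) + 1))) / (x - x⁻¹)
  else if k % l = l - 1 then
    (x ^ ((((k / l : ℕ) : ℤ) + 1) * l) - x ^ (-((((k / l : ℕ) : ℤ) + 1) * l))) / (x - x⁻¹)
  else
    (x ^ (((k % l : ℕ) : ℤ) + 1) + x ^ (-(((k % l : ℕ) : ℤ) + 1))) *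
      (x ^ (((k / l : ℕ) : ℤ) * l) - x ^ (-(((k / l : ℕ) : ℤ) * l))) / (x - x⁻¹)

theorem ib_zero (N : ℕ) (j : ℤ) (h : j < 0 ∨ (N : ℤ) < j) : intBinom N j = 0 := by
  unfold intBinom
  rw [if_neg (by omega)]

theorem ib_nat (N j : ℕ) : intBinom N (j : ℤ) = (N.choose j : ℤ) := by
  unfold intBinom
  split_ifs with h
  · simp
  · rw [Nat.choose_eq_zero_of_lt (by omega)]; simp

theorem ib_pascal (N : ℕ) (j : ℤ) : intBinom (N + 1) j = intBinom N j + intBinom N (j - 1) := by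
  rcases lt_or_ge j 0 with h | h
  · rw [ib_zero _ _ (Or.inl h), ib_zero _ _ (Or.inl h), ib_zero _ _ (Or.inl (by omega))]; rfl
  · obtain ⟨n, rfl⟩ := Int.eq_ofNat_of_zero_le h
    cases n with
    | zero =>
      rw [ib_zero N (((0 : ℕ) : ℤ) - 1) (Or.inl (by simp)), ib_nat, ib_nat]; simp
    | succ n =>
      have : ((n + 1 : ℕ) : ℤ) - 1 = (n : ℤ) := by push_cast; ring
      rw [this, ib_nat, ib_nat, ib_nat, Nat.choose_succ_succ]; push_cast; ring

theorem F_pascal (N : ℕ) (k : ℤ) : Fcoef (N + 1) k = Fcoef N (k - 1) + Fcoef N (k + 1) := by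
  unfold Fcoef
  by_cases h : ((N : ℤ) - k) % 2 = 0
  · rw [if_neg (by push_cast; omega), if_neg (by omega), if_neg (by omega)]; rfl
  · rw [if_pos (by push_cast; omega), if_pos (by omega), if_pos (by omega), ib_pascal, ib_pascal]
    have e1 : (((N + 1 : ℕ) : ℤ) - k) / 2 = ((N : ℤ) - (k - 1)) / 2 := by push_cast; congr 1; ring
    have e2 : (((N + 1 : ℕ) : ℤ) - k - 2) / 2 = ((N : ℤ) - (k - 1) - 2) / 2 := by
      push_cast; congr 1; ring
    have e3 : ((N : ℤ) - (k - 1)) / 2 - 1 = ((N : ℤ) - (k + 1)) / 2 := by omega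
    have e4 : ((N : ℤ) - (k - 1) - 2) / 2 - 1 = ((N : ℤ) - (k + 1) - 2) / 2 := by omega
    rw [e1, e2, e3, e4]; ring

theorem F_zero (N : ℕ) (k : ℤ) (h : (N : ℤ) < k) : Fcoef N k = 0 := by
  unfold Fcoef
  split_ifs with h2
  · rw [ib_zero _ _ (Or.inl (by omega)), ib_zero _ _ (Or.inl (by omega))]; rfl
  · rfl

theorem F_neg_one (N : ℕ) : Fcoef N (-1) = 0 := by
  unfold Fcoef
  split_ifs with h2
  · obtain ⟨m, rfl⟩ : ∃ m, N = 2 * m + 1 := ⟨N / 2, by omega⟩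
    have e1 : (((2 * m + 1 : ℕ) : ℤ) - (-1)) / 2 = ((m + 1 : ℕ) : ℤ) := by push_cast; omega
    have e2 : (((2 * m + 1 : ℕ) : ℤ) - (-1) - 2) / 2 = (m : ℤ) := by push_cast; omega
    rw [e1, e2, ib_nat, ib_nat, Nat.choose_symm_half]; simp
  · rfl

/-- Numerator of the Weyl character. -/
noncomputable def Dnum (x : ℂ) (k : ℤ) : ℂ := x ^ (k + 1) - x ^ (-(k + 1))

theorem D_mul (x : ℂ) (hx : x ≠ 0) (k : ℤ) :
    (x + x⁻¹) * Dnum x k = Dnum x (k + 1) + Dnum x (k - 1) := by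
  unfold Dnum
  have e1 : x ^ (k + 1 + 1) = x ^ (k + 1) * x := by rw [zpow_add_one₀ hx]
  have e2 : x ^ (k - 1 + 1) = x ^ (k + 1) * x⁻¹ := by
    rw [← zpow_sub_one₀ hx]; congr 1; ring
  have e3 : x ^ (-(k + 1 + 1)) = x ^ (-(k + 1)) * x⁻¹ := by
    rw [← zpow_sub_one₀ hx]; congr 1; ring
  have e4 : x ^ (-(k - 1 + 1)) = x ^ (-(k + 1)) * x := by
    rw [← zpow_add_one₀ hx]; congr 1; ring
  rw [e1, e2, e3, e4]; ring

theorem weyl (x : ℂ) (hx : x ≠ 0) (N : ℕ) :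
    (x - x⁻¹) * (x + x⁻¹) ^ N = ∑ k ∈ Finset.range (N + 1), (Fcoef N k : ℂ) * Dnum x k := by
  induction N with
  | zero => simp [Fcoef, intBinom, Dnum]
  | succ N ih =>
    rw [pow_succ, ← mul_assoc, ih, mul_comm, Finset.mul_sum]
    have hL : ∀ k ∈ Finset.range (N + 1), (x + x⁻¹) * ((Fcoef N k : ℂ) * Dnum x k)
        = (Fcoef N k : ℂ) * Dnum x (k + 1) + (Fcoef N k : ℂ) * Dnum x (k - 1) := by
      intro k _
      rw [← mul_add, ← D_mul x hx]; ring
    have hR : ∀ k ∈ Finset.range (N + 1 + 1), (Fcoef (N + 1) k : ℂ) * Dnum x k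
        = (Fcoef N ((k : ℤ) - 1) : ℂ) * Dnum x k + (Fcoef N ((k : ℤ) + 1) : ℂ) * Dnum x k := by
      intro k _
      rw [F_pascal]; push_cast; ring
    rw [Finset.sum_congr rfl hL, Finset.sum_congr rfl hR, Finset.sum_add_distrib,
      Finset.sum_add_distrib]
    congr 1
    · rw [Finset.sum_range_succ' _ (N + 1)]
      simp [F_neg_one]
    · have h1 := Finset.sum_range_succ' (fun k : ℕ => (Fcoef N k : ℂ) * Dnum x ((k : ℤ) - 1)) (N + 2)
      rw [Finset.sum_range_succ, Finset.sum_range_succ, F_zero N ((N + 2 : ℕ) : ℤ) (by push_cast; omega),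
        F_zero N ((N + 1 : ℕ) : ℤ) (by push_cast; omega)] at h1
      simpa [Dnum] using h1

theorem dm (l q r : ℕ) (h : r < l) : (q * l + r) / l = q ∧ (q * l + r) % l = r := by
  constructor
  · rw [mul_comm, Nat.mul_add_div (by omega), Nat.div_eq_of_lt h]; rfl
  · rw [mul_comm, Nat.mul_add_mod, Nat.mod_eq_of_lt h]

theorem M_rel (l q r s N : ℕ) (h : r + s + 2 = l) :
    Mmult l (q * l + r) N + Mmult l ((q + 1) * l + s) N = Fcoef N ((q * l + r : ℕ) : ℤ) := by
  obtain ⟨a1, a2⟩ := dm l q r (by omega)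
  obtain ⟨b1, b2⟩ := dm l (q + 1) s (by omega)
  unfold Mmult
  rw [a1, a2, b1, b2, if_neg (by omega), if_neg (by omega), ← Finset.sum_add_distrib]
  have hl : (l : ℤ) = r + s + 2 := by rw [← h]; push_cast; ring
  have := Finset.sum_range_sub' (fun j : ℕ => Fcoef N (((q * l + r : ℕ) : ℤ) + 2 * j * l)) (N + 1)
  rw [F_zero N (((q * l + r : ℕ) : ℤ) + 2 * (N + 1 : ℕ) * l) (by
    push_cast
    have : (0 : ℤ) ≤ q * l := by positivity
    have : (0 : ℤ) ≤ N * l := by positivity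
    nlinarith)] at this
  simp only [Nat.cast_zero, mul_zero, zero_mul, add_zero, sub_zero] at this
  rw [← this]
  refine Finset.sum_congr rfl fun j _ => ?_
  have e1 : ((q : ℤ) + 2 * j + 2) * l - r - 2 = (((q + 1) * l + s : ℕ) : ℤ) + 2 * j * l := by
    push_cast; linear_combination (1 : ℤ) * hl
  have e2 : (((q + 1 : ℕ) : ℤ) + 2 * j + 2) * l - s - 2
      = ((q * l + r : ℕ) : ℤ) + 2 * (j + 1 : ℕ) * l := by
    push_cast; linear_combination (1 : ℤ) * hl
  rw [e1, e2]; ring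

theorem M_zero (l k N : ℕ) (hl : 2 ≤ l) (h : N < k) : Mmult l k N = 0 := by
  unfold Mmult
  split_ifs with h1
  · exact F_zero _ _ (by omega)
  · refine Finset.sum_eq_zero fun j _ => ?_
    have hr := Nat.mod_lt k (show 0 < l by omega)
    have hk : (k : ℤ) = l * (k / l : ℕ) + (k % l : ℕ) := by exact_mod_cast (Nat.div_add_mod k l).symm
    have hj : (0 : ℤ) ≤ j * l := by positivity
    rw [F_zero, F_zero]; rfl
    · have : ((k % l : ℕ) : ℤ) + 2 ≤ l := by omega
      nlinarith
    · nlinarith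

theorem chT_eq (l k : ℕ) (x : ℂ) (hl : 2 ≤ l) (hx : x ≠ 0) :
    chT l k x = (Dnum x k + if k / l ≠ 0 ∧ k % l ≠ l - 1 then
      Dnum x ((k / l * l - k % l - 2 : ℕ) : ℤ) else 0) / (x - x⁻¹) := by
  have hr := Nat.mod_lt k (show 0 < l by omega)
  have hk : (k : ℤ) = l * (k / l : ℕ) + (k % l : ℕ) := by exact_mod_cast (Nat.div_add_mod k l).symm
  unfold chT
  by_cases h1 : k / l = 0
  · rw [if_pos h1, if_neg (by tauto), add_zero]
    unfold Dnum
    rw [hk, h1]; simp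
  rw [if_neg h1]
  by_cases h2 : k % l = l - 1
  · rw [if_pos h2, if_neg (by tauto), add_zero]
    unfold Dnum
    have : (k : ℤ) + 1 = (((k / l : ℕ) : ℤ) + 1) * l := by
      have : ((k % l : ℕ) : ℤ) = l - 1 := by omega
      rw [this] at hk; linear_combination hk
    rw [this]
  · rw [if_neg h2, if_pos ⟨h1, h2⟩]
    congr 1
    unfold Dnum
    have hq : 1 * l ≤ k / l * l := Nat.mul_le_mul_right _ (Nat.pos_of_ne_zero h1)
    have e : ((k / l * l - k % l - 2 : ℕ) : ℤ) = ((k / l : ℕ) : ℤ) * l - (k % l : ℕ) - 2 := by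
      rw [← Nat.cast_mul]; omega
    rw [e]
    generalize ((k / l : ℕ) : ℤ) = q at *
    generalize ((k % l : ℕ) : ℤ) = r at *
    have t1 : (k : ℤ) + 1 = (r + 1) + q * l := by rw [hk]; ring
    have t2 : q * l - r - 2 + 1 = -(r + 1) + q * l := by ring
    have t3 : -((r + 1) + q * l) = -(r + 1) + -(q * l) := by ring
    have t4 : -(-(r + 1) + q * l) = (r + 1) + -(q * l) := by ring
    rw [t1, t2, t3, t4, zpow_add₀ hx (r + 1) (q * l), zpow_add₀ hx (-(r + 1)) (-(q * l)),
      zpow_add₀ hx (-(r + 1)) (q * l), zpow_add₀ hx (r + 1) (-(q * l))]; ring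

theorem reidx (l N : ℕ) (hl : 2 ≤ l) (x : ℂ) :
    ∑ k ∈ Finset.range (N + 1), (if k / l ≠ 0 ∧ k % l ≠ l - 1 then
      (Mmult l k N : ℂ) * Dnum x ((k / l * l - k % l - 2 : ℕ) : ℤ) else 0)
    = ∑ m ∈ Finset.range (N + 1), (if m % l ≠ l - 1 then
      (Mmult l ((m / l + 1) * l + (l - 2 - m % l)) N : ℂ) * Dnum x (m : ℤ) else 0) := by
  have key : ∀ k : ℕ, k / l ≠ 0 → k % l ≠ l - 1 → ∃ q r s, r + s + 2 = l ∧ k = (q + 1) * l + s ∧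
      k / l * l - k % l - 2 = q * l + r ∧ k / l = q + 1 ∧ k % l = s := by
    intro k h1 h2
    have hr := Nat.mod_lt k (show 0 < l by omega)
    have hk := Nat.div_add_mod k l
    obtain ⟨q, hq⟩ := Nat.exists_eq_succ_of_ne_zero h1
    refine ⟨q, l - 2 - k % l, k % l, by omega, ?_, ?_, hq, rfl⟩
    · rw [hq] at hk; rw [mul_comm]; exact hk.symm
    · rw [hq, Nat.succ_mul]; omega
  have key2 : ∀ m : ℕ, m % l ≠ l - 1 → ∃ q r s, r + s + 2 = l ∧ m = q * l + r ∧
      m / l = q ∧ m % l = r ∧ l - 2 - m % l = s := by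
    intro m h2
    have hr := Nat.mod_lt m (show 0 < l by omega)
    have hk := Nat.div_add_mod m l
    exact ⟨m / l, m % l, l - 2 - m % l, by omega, by rw [mul_comm]; exact hk.symm, rfl, rfl, rfl⟩
  refine Finset.sum_bij_ne_zero (fun k _ _ => k / l * l - k % l - 2) ?_ ?_ ?_ ?_
  · intro k hk hne
    split_ifs at hne with h
    · obtain ⟨q, r, s, h1, h2, h3, -, -⟩ := key k h.1 h.2
      rw [h3]
      rw [Finset.mem_range] at *
      have : (q + 1) * l = q * l + l := by ring
      omega
    · exact absurd rfl hne
  · intro k hk hne k' hk' hne' heq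
    split_ifs at hne with h
    · split_ifs at hne' with h'
      · obtain ⟨q, r, s, h1, h2, h3, -, -⟩ := key k h.1 h.2
        obtain ⟨q', r', s', h1', h2', h3', -, -⟩ := key k' h'.1 h'.2
        rw [h3, h3'] at heq
        have a := dm l q r (by omega)
        have b := dm l q' r' (by omega)
        rw [heq] at a
        have e1 : q = q' := by rw [← a.1, b.1]
        have e2 : r = r' := by rw [← a.2, b.2]
        have e3 : s = s' := by omega
        rw [h2, h2', e1, e3]
      · exact absurd rfl hne'
    · exact absurd rfl hne
  · intro m hm hne
    split_ifs at hne with h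
    · obtain ⟨q, r, s, h1, h2, h3, h4, h5⟩ := key2 m h
      rw [h3, h5] at hne
      have hle : (q + 1) * l + s < N + 1 := by
        by_contra hcon
        rw [M_zero l _ N hl (by omega)] at hne
        simp at hne
      obtain ⟨b1, b2⟩ := dm l (q + 1) s (by omega)
      have e : (q + 1) * l - s - 2 = m := by
        have : (q + 1) * l = q * l + l := by ring
        omega
      refine ⟨(q + 1) * l + s, Finset.mem_range.2 hle, ?_, ?_⟩
      · rw [b1, b2, if_pos ⟨by omega, by omega⟩, e]; exact hne
      · simp only [b1, b2]; exact e
    · exact absurd rfl hne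
  · intro k hk hne
    split_ifs at hne with h
    · obtain ⟨q, r, s, h1, h2, h3, h4, h5⟩ := key k h.1 h.2
      rw [if_pos h, h3]
      obtain ⟨b1, b2⟩ := dm l q r (by omega)
      rw [b1, b2, if_pos (by omega), show l - 2 - r = s by omega, ← h2]
    · exact absurd rfl hne

theorem stmt5 (l : ℕ) (hl : Odd l) (hl3 : 3 ≤ l) (N : ℕ)
    (x : ℂ) (hx0 : x ≠ 0) (hx1 : x ≠ 1) (hx2 : x ≠ -1) :
    (x + x⁻¹) ^ N = ∑ k ∈ Finset.range (N + 1), (Mmult l k N : ℂ) * chT l k x := by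
  have hd : x - x⁻¹ ≠ 0 := by
    intro h
    have h2 : (x - 1) * (x + 1) = 0 := by
      have : x * (x - x⁻¹) = 0 := by rw [h, mul_zero]
      rw [mul_sub, mul_inv_cancel₀ hx0] at this
      linear_combination this
    rcases mul_eq_zero.1 h2 with h3 | h3
    · exact hx1 (sub_eq_zero.1 h3)
    · exact hx2 (eq_neg_of_add_eq_zero_left h3)
  apply mul_left_cancel₀ hd
  rw [weyl x hx0, Finset.mul_sum]
  have hT : ∀ k ∈ Finset.range (N + 1), (x - x⁻¹) * ((Mmult l k N : ℂ) * chT l k x)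
      = (Mmult l k N : ℂ) * Dnum x k + (if k / l ≠ 0 ∧ k % l ≠ l - 1 then
      (Mmult l k N : ℂ) * Dnum x ((k / l * l - k % l - 2 : ℕ) : ℤ) else 0) := by
    intro k _
    rw [chT_eq l k x (by omega) hx0, mul_left_comm, mul_div_cancel₀ _ hd, mul_add, mul_ite, mul_zero]
  rw [Finset.sum_congr rfl hT, Finset.sum_add_distrib, reidx l N (by omega), ← Finset.sum_add_distrib]
  refine Finset.sum_congr rfl fun k _ => ?_
  split_ifs with h
  · have hr := Nat.mod_lt k (show 0 < l by omega)
    have := M_rel l (k / l) (k % l) (l - 2 - k % l) N (by omega)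
    rw [mul_comm (k / l) l, Nat.div_add_mod] at this
    rw [← this]; push_cast; ring
  · rw [add_zero]
    unfold Mmult
    rw [if_pos (not_not.1 h)]
end

section
/- Let l ≥ 3 be an odd integer, N ∈ ℕ, and k₀ ∈ {0, …, l−2}. Then Σ_{j ∈ ℤ, j even} Σ_{m=0}^{∞} M^{(l)}_{l + k₀ + |j|l + 2ml}(N) = Σ_{m=0}^{∞} (m+1)² F^{(N)}_{(2m+1)l + k₀} + Σ_{m=1}^{∞} m² F^{(N)}_{k₀ − (2m+1)l}. (All sums have only finitely many nonzero terms; some of the numbers F^{(N)}_{k₀−(2m+1)l} may be negative.) -/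
lemma intBinom_zero (N : ℕ) (j : ℤ) (h : j < 0 ∨ (N:ℤ) < j) : intBinom N j = 0 := by
  unfold intBinom
  rw [if_neg]; omega

lemma intBinom_symm (N : ℕ) (j : ℤ) : intBinom N ((N:ℤ) - j) = intBinom N j := by
  unfold intBinom
  by_cases h : 0 ≤ j ∧ j ≤ (N:ℤ)
  · rw [if_pos h, if_pos (by omega)]
    have : ((N:ℤ) - j).toNat = N - j.toNat := by omega
    rw [this, Nat.choose_symm (by omega)]
  · rw [if_neg h, if_neg (by omega)]

lemma Fcoef_zero (N : ℕ) (k : ℤ) (h : (N:ℤ) < k ∨ k < -(N:ℤ) - 2) : Fcoef N k = 0 := by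
  unfold Fcoef
  split_ifs with h2
  · rw [intBinom_zero, intBinom_zero, sub_zero] <;> omega
  · rfl

lemma Fcoef_neg (N : ℕ) (k k' : ℤ) (h : k' = -k - 2) : Fcoef N k' = - Fcoef N k := by
  subst h
  unfold Fcoef
  by_cases h2 : ((N:ℤ) - k) % 2 = 0
  · rw [if_pos h2, if_pos (by omega)]
    have e1 : ((N:ℤ) - (-k-2)) / 2 = (N:ℤ) - ((N:ℤ) - k - 2)/2 := by omega
    have e2 : ((N:ℤ) - (-k-2) - 2) / 2 = (N:ℤ) - ((N:ℤ) - k)/2 := by omega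
    rw [e1, e2, intBinom_symm, intBinom_symm]; ring
  · rw [if_neg h2, if_neg (by omega)]; rfl

lemma conv_sum (n : ℕ) (w G : ℕ → ℤ) (hG : ∀ s, n ≤ s → G s = 0) :
    ∑ a ∈ Finset.range n, ∑ u ∈ Finset.range n, w u * G (a + u)
      = ∑ s ∈ Finset.range n, (∑ u ∈ Finset.range (s+1), w u) * G s := by
  rw [Finset.sum_comm]
  have h1 : ∀ u ∈ Finset.range n, ∑ a ∈ Finset.range n, w u * G (a + u)
      = ∑ s ∈ Finset.Ico u n, w u * G s := by
    intro u hu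
    have hu' := Finset.mem_range.1 hu
    have : ∑ a ∈ Finset.range n, w u * G (a + u) = ∑ s ∈ Finset.Ico u (n + u), w u * G s := by
      rw [Finset.sum_Ico_eq_sum_range, Nat.add_sub_cancel]
      simp only [add_comm]
    rw [this]
    symm
    apply Finset.sum_subset
    · intro x; simp only [Finset.mem_Ico]; omega
    · intro x hx hx'
      simp only [Finset.mem_Ico] at hx hx'
      rw [hG x (by omega), mul_zero]
  rw [Finset.sum_congr rfl h1, Finset.range_eq_Ico, Finset.sum_Ico_Ico_comm]
  simp only [Finset.sum_mul, Finset.range_eq_Ico]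

lemma sum_abs (N : ℕ) (h : ℕ → ℤ) : ∑ j ∈ Finset.Icc (-(N:ℤ)) N, h j.natAbs
    = h 0 + 2 * ∑ i ∈ Finset.range N, h (i+1) := by
  induction N with
  | zero => simp
  | succ N ih =>
    have : Finset.Icc (-((N+1:ℕ):ℤ)) ((N+1:ℕ):ℤ)
        = insert (-((N:ℤ)+1)) (insert ((N:ℤ)+1) (Finset.Icc (-(N:ℤ)) N)) := by
      ext x; simp only [Finset.mem_Icc, Finset.mem_insert]; omega
    rw [this, Finset.sum_insert, Finset.sum_insert, ih, Finset.sum_range_succ]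
    · have e1 : (-((N:ℤ)+1)).natAbs = N+1 := by omega
      have e2 : ((N:ℤ)+1).natAbs = N+1 := by omega
      rw [e1, e2]; ring
    · simp only [Finset.mem_Icc]; omega
    · simp only [Finset.mem_Icc, Finset.mem_insert]; omega

lemma sum_even (N : ℕ) (g : ℕ → ℤ) :
    ∑ i ∈ Finset.range N, (if Even (i+1) then g ((i+1)/2) else 0)
      = ∑ i ∈ Finset.range (N/2), g (i+1) := by
  induction N with
  | zero => simp
  | succ N ih =>
    rw [Finset.sum_range_succ, ih]
    split_ifs with h
    · rw [Nat.even_iff] at h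
      have : (N+1)/2 = N/2 + 1 := by omega
      rw [this, Finset.sum_range_succ]
    · rw [Nat.even_iff] at h
      have : (N+1)/2 = N/2 := by omega
      rw [this, add_zero]

lemma tri (s : ℕ) : 2 * ∑ u ∈ Finset.range s, ((u:ℤ)+1) = s * (s+1) := by
  induction s with
  | zero => simp
  | succ s ih => rw [Finset.sum_range_succ, mul_add, ih]; push_cast; ring

lemma main_sum (N : ℕ) (G : ℕ → ℤ) (hG : ∀ s, N ≤ 2 * s → 0 < s → G s = 0) :
    ∑ j ∈ (Finset.Icc (-(N : ℤ)) (N : ℤ)).filter (fun j => Even j),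
      ∑ m ∈ Finset.range (N + 1), ∑ t ∈ Finset.range (N + 1), G (j.natAbs / 2 + m + t)
    = ∑ s ∈ Finset.range (N + 1), ((s:ℤ)+1)^2 * G s := by
  have hd : ∀ a, ∑ m ∈ Finset.range (N + 1), ∑ t ∈ Finset.range (N + 1), G (a + m + t)
      = ∑ u ∈ Finset.range (N+1), ((u:ℤ)+1) * G (a + u) := by
    intro a
    have := conv_sum (N+1) (fun _ => 1) (fun s => G (a + s))
      (fun s hs => hG _ (by omega) (by omega))
    simp only [one_mul, Finset.sum_const, Finset.card_range, nsmul_eq_mul, mul_one,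
      ← add_assoc] at this
    rw [this]; push_cast; rfl
  simp only [hd]
  set g : ℕ → ℤ := fun a => ∑ u ∈ Finset.range (N+1), ((u:ℤ)+1) * G (a + u) with hg
  rw [Finset.sum_filter]
  have e := sum_abs N (fun a => if Even a then g (a/2) else 0)
  simp only [Int.natAbs_even] at e
  rw [show (∑ a ∈ Finset.Icc (-(N:ℤ)) N, if Even a then
    ∑ u ∈ Finset.range (N+1), ((u:ℤ)+1) * G (a.natAbs/2 + u) else 0) = _ from e, sum_even]
  have hz : ∑ i ∈ Finset.range (N/2), g (i+1) = ∑ i ∈ Finset.range (N+1), g (i+1) := by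
    apply Finset.sum_subset
    · intro x; simp only [Finset.mem_range]; omega
    · intro x hx hx'
      simp only [Finset.mem_range] at hx hx'
      apply Finset.sum_eq_zero
      intro u _
      rw [hG _ (by omega) (by omega), mul_zero]
  have h2 : ∑ i ∈ Finset.range (N+1), g (i+1)
      = ∑ s ∈ Finset.range (N+1), (∑ u ∈ Finset.range s, ((u:ℤ)+1)) * G s := by
    have := conv_sum (N+1) (fun u => (u:ℤ)+1) (fun s => G (s+1))
      (fun s hs => hG _ (by omega) (by omega))
    simp only [hg, add_right_comm _ 1 _]
    rw [this, Finset.sum_range_succ' (fun s => (∑ u ∈ Finset.range s, ((u:ℤ)+1)) * G s),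
      Finset.sum_range_succ, hG (N+1) (by omega) (by omega)]
    simp
  rw [hz, h2, Finset.mul_sum]
  simp only [Even.zero, if_true, Nat.zero_div, hg, zero_add]
  rw [← Finset.sum_add_distrib]
  apply Finset.sum_congr rfl
  intro s _
  rw [← mul_assoc, tri]; ring

lemma Mmult_eq (l N k₀ b : ℕ) (hl3 : 3 ≤ l) (hk₀ : k₀ ≤ l - 2) :
    Mmult l (l + k₀ + 2 * b * l) N = ∑ t ∈ Finset.range (N+1),
      (Fcoef N ((2 * ((b + t : ℕ):ℤ) + 1) * l + k₀)
        + Fcoef N ((k₀:ℤ) - (2 * (((b + t : ℕ):ℤ) + 1) + 1) * l)) := by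
  have e : l + k₀ + 2 * b * l = k₀ + l * (2*b+1) := by ring
  have em : (l + k₀ + 2 * b * l) % l = k₀ := by
    rw [e, Nat.add_mul_mod_self_left, Nat.mod_eq_of_lt (by omega)]
  have ed : (l + k₀ + 2 * b * l) / l = 2*b+1 := by
    rw [e, Nat.add_mul_div_left _ _ (by omega), Nat.div_eq_of_lt (by omega), zero_add]
  unfold Mmult
  rw [em, ed, if_neg (by omega)]
  apply Finset.sum_congr rfl
  intro t _
  rw [Fcoef_neg N (((((2*b+1 : ℕ)) : ℤ) + 2 * (t : ℤ) + 2) * l - (k₀ : ℤ) - 2)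
    ((k₀:ℤ) - (2 * (((b + t : ℕ):ℤ) + 1) + 1) * l) (by push_cast; ring), ← sub_eq_add_neg]
  congr 2
  push_cast; ring

/-- All infinite sums in the statement have finitely many nonzero terms: `M^{(l)}_k(N) = 0`
for `k > N` and `F^{(N)}_k = 0` for `k > N` or `k < −N−2`, so the sums over `j` (even integers),
`m ≥ 0` and `m ≥ 1` are truncated at `|j| ≤ N`, `m ≤ N` without changing their values. -/
theorem stmt7 (l : ℕ) (hl : Odd l) (hl3 : 3 ≤ l) (N k₀ : ℕ) (hk₀ : k₀ ≤ l - 2) :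
    ∑ j ∈ (Finset.Icc (-(N : ℤ)) (N : ℤ)).filter (fun j => Even j),
      ∑ m ∈ Finset.range (N + 1), Mmult l (l + k₀ + j.natAbs * l + 2 * m * l) N
    = ∑ m ∈ Finset.range (N + 1), ((m : ℤ) + 1) ^ 2 * Fcoef N ((2 * m + 1) * l + k₀)
      + ∑ m ∈ Finset.Icc 1 N, (m : ℤ) ^ 2 * Fcoef N ((k₀ : ℤ) - (2 * m + 1) * l) := by
  have hl2 : (k₀:ℤ) + 2 ≤ l := by omega
  have hl3' : (3:ℤ) ≤ l := by omega
  set G : ℕ → ℤ := fun s => Fcoef N ((2 * (s:ℤ) + 1) * l + k₀)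
        + Fcoef N ((k₀:ℤ) - (2 * ((s:ℤ) + 1) + 1) * l) with hGdef
  have hz1 : ∀ s : ℕ, N ≤ 2 * s → Fcoef N ((2 * (s:ℤ) + 1) * l + k₀) = 0 := by
    intro s hs
    apply Fcoef_zero
    left
    have : (N:ℤ) ≤ 2 * s := by exact_mod_cast hs
    nlinarith
  have hz2 : ∀ s : ℕ, N ≤ 2 * s → Fcoef N ((k₀:ℤ) - (2 * ((s:ℤ) + 1) + 1) * l) = 0 := by
    intro s hs
    apply Fcoef_zero
    right
    have : (N:ℤ) ≤ 2 * s := by exact_mod_cast hs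
    nlinarith
  have hM := main_sum N G (fun s hs _ => by simp only [hGdef]; rw [hz1 s hs, hz2 s hs, add_zero])
  have hL : ∑ j ∈ (Finset.Icc (-(N : ℤ)) (N : ℤ)).filter (fun j => Even j),
      ∑ m ∈ Finset.range (N + 1), Mmult l (l + k₀ + j.natAbs * l + 2 * m * l) N
      = ∑ j ∈ (Finset.Icc (-(N : ℤ)) (N : ℤ)).filter (fun j => Even j),
      ∑ m ∈ Finset.range (N + 1), ∑ t ∈ Finset.range (N + 1), G (j.natAbs / 2 + m + t) := by
    apply Finset.sum_congr rfl
    intro j hj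
    apply Finset.sum_congr rfl
    intro m _
    have hj2 : Even j.natAbs := Int.natAbs_even.2 (Finset.mem_filter.1 hj).2
    have h3 : j.natAbs = 2 * (j.natAbs / 2) := by rw [Nat.even_iff] at hj2; omega
    rw [← Mmult_eq l N k₀ _ hl3 hk₀]
    congr 1
    conv_lhs => rw [h3]
    ring
  rw [hL, hM]
  have hsplit : ∀ s : ℕ, ((s:ℤ)+1)^2 * G s = ((s:ℤ)+1)^2 * Fcoef N ((2 * (s:ℤ) + 1) * l + k₀)
      + ((s:ℤ)+1)^2 * Fcoef N ((k₀:ℤ) - (2 * ((s:ℤ) + 1) + 1) * l) := fun s => mul_add _ _ _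
  simp only [hsplit, Finset.sum_add_distrib]
  congr 1
  rw [Finset.sum_range_succ, hz2 N (by omega), mul_zero, add_zero]
  have hI : Finset.Icc 1 N = Finset.Ico 1 (N+1) := by ext x; simp only [Finset.mem_Icc, Finset.mem_Ico]; omega
  rw [hI, Finset.sum_Ico_eq_sum_range, Nat.add_sub_cancel]
  apply Finset.sum_congr rfl
  intro s _
  push_cast
  rw [add_comm (1:ℤ)]
end

section
/- For every integer n ≥ 1: Σ_{j=0}^{n−1} (−1)^{j+1} 4^{j} · binom(n+j, 2j+1) = (−1)^{n} n, and Σ_{j=0}^{n−1} (−1)^{j+1} 4^{j} · binom(n+j−1, 2j) = (−1)^{n} (2n−1), where binom denotes the ordinary binomial coefficient. -/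
theorem stmt9_aux (m : ℕ) :
    (∑ j ∈ Finset.range (m+1), (-1 : ℤ) ^ (j + 1) * 4 ^ j * ((m + 1 + j).choose (2 * j + 1) : ℤ)
        = (-1) ^ (m+1) * ((m : ℤ) + 1)) ∧
    (∑ j ∈ Finset.range (m+1), (-1 : ℤ) ^ (j + 1) * 4 ^ j * ((m + j).choose (2 * j) : ℤ)
        = (-1) ^ (m+1) * (2 * (m : ℤ) + 1)) := by
  induction m with
  | zero => simp
  | succ m ih =>
    obtain ⟨hA, hB⟩ := ih
    have h2 : ∑ j ∈ Finset.range (m+1+1),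
        (-1 : ℤ) ^ (j + 1) * 4 ^ j * ((m + 1 + j).choose (2 * j) : ℤ)
        = (-1) ^ (m+1+1) * (2 * ((m : ℤ) + 1) + 1) := by
      have e : ∑ j ∈ Finset.range (m+1+1),
          (-1 : ℤ) ^ (j + 1) * 4 ^ j * ((m + j).choose (2 * j) : ℤ)
          = (-1) ^ (m+1) * (2 * (m : ℤ) + 1) := by
        rw [Finset.sum_range_succ, hB, Nat.choose_eq_zero_of_lt (by omega)]
        simp
      rw [Finset.sum_range_succ'] at e ⊢
      have s : ∀ i ∈ Finset.range (m+1),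
          (-1 : ℤ) ^ (i + 1 + 1) * 4 ^ (i + 1) * ((m + 1 + (i + 1)).choose (2 * (i + 1)) : ℤ)
          = (-4) * ((-1 : ℤ) ^ (i + 1) * 4 ^ i * ((m + 1 + i).choose (2 * i + 1) : ℤ))
            + (-1 : ℤ) ^ (i + 1 + 1) * 4 ^ (i + 1) * ((m + (i + 1)).choose (2 * (i + 1)) : ℤ) := by
        intro i _
        have c : (m + 1 + (i + 1)).choose (2 * (i + 1))
            = (m + 1 + i).choose (2 * i + 1) + (m + (i + 1)).choose (2 * (i + 1)) := by
          rw [show m + (i + 1) = m + 1 + i by omega]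
          exact Nat.choose_succ_succ (m + 1 + i) (2 * i + 1)
        rw [c]; push_cast; ring
      rw [Finset.sum_congr rfl s, Finset.sum_add_distrib, ← Finset.mul_sum, hA]
      simp only [Nat.mul_zero, Nat.choose_zero_right] at e ⊢
      rw [add_assoc, e]
      ring
    refine ⟨?_, by push_cast; exact h2⟩
    have s : ∀ j ∈ Finset.range (m+1+1),
        (-1 : ℤ) ^ (j + 1) * 4 ^ j * ((m + 1 + 1 + j).choose (2 * j + 1) : ℤ)
        = (-1 : ℤ) ^ (j + 1) * 4 ^ j * ((m + 1 + j).choose (2 * j) : ℤ)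
          + (-1 : ℤ) ^ (j + 1) * 4 ^ j * ((m + 1 + j).choose (2 * j + 1) : ℤ) := by
      intro j _
      rw [show m + 1 + 1 + j = (m + 1 + j) + 1 by omega, Nat.choose_succ_succ]
      push_cast; ring
    rw [Finset.sum_congr rfl s, Finset.sum_add_distrib, h2, Finset.sum_range_succ, hA,
      Nat.choose_eq_zero_of_lt (show m + 1 + (m + 1) < 2 * (m + 1) + 1 by omega)]
    push_cast; ring

theorem stmt9 (n : ℕ) (hn : 1 ≤ n) :
    (∑ j ∈ Finset.range n, (-1 : ℤ) ^ (j + 1) * 4 ^ j * ((n + j).choose (2 * j + 1) : ℤ)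
        = (-1) ^ n * (n : ℤ)) ∧
    (∑ j ∈ Finset.range n, (-1 : ℤ) ^ (j + 1) * 4 ^ j * ((n + j - 1).choose (2 * j) : ℤ)
        = (-1) ^ n * (2 * (n : ℤ) - 1)) := by
  obtain ⟨m, rfl⟩ : ∃ m, n = m + 1 := ⟨n - 1, by omega⟩
  obtain ⟨hA, hB⟩ := stmt9_aux m
  refine ⟨by push_cast; exact hA, ?_⟩
  have s : ∀ j, m + 1 + j - 1 = m + j := fun j => by omega
  simp only [s]
  rw [hB]; push_cast; ring
end

section
/- Let n ≥ 0 be an even integer. Then (n+1)² = Σ_{j odd, 1 ≤ j ≤ n+1} 4^{j−1} · P_{2j}((n−j+1)/2) − Σ_{j even, 2 ≤ j ≤ n} 4^{j−1} · Q_{2j}((n−j)/2). -/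
/-- `intChoose a b = binom(a, b)` for an integer `a`, with the convention that it vanishes
whenever `a < 0`, `b < 0` or `b > a`. -/
def intChoose (a : ℤ) (b : ℕ) : ℤ :=
  if 0 ≤ a then (a.toNat.choose b : ℤ) else 0

/-- `Pfun j k = P_j(k) = Σ_{i=0}^{⌊j/2⌋} binom(j−2, 2i) · binom(k−i+j−2, j−2)`. -/
def Pfun (j k : ℕ) : ℤ :=
  ∑ i ∈ Finset.range (j / 2 + 1),
    ((j - 2).choose (2 * i) : ℤ) * intChoose ((k : ℤ) - i + j - 2) (j - 2)

/-- `Qfun j k = Q_j(k) = Σ_{i=0}^{⌊j/2⌋} binom(j−2, 2i+1) · binom(k−i+j−2, j−2)`. -/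
def Qfun (j k : ℕ) : ℤ :=
  ∑ i ∈ Finset.range (j / 2 + 1),
    ((j - 2).choose (2 * i + 1) : ℤ) * intChoose ((k : ℤ) - i + j - 2) (j - 2)

open PowerSeries in
theorem aux_coeff (a : PowerSeries ℤ) (n : ℕ) :
    coeff (n+1) ((1 + X) * a) = coeff (n+1) a + coeff n a := by
  rw [add_mul, one_mul, map_add, coeff_succ_X_mul]

noncomputable def Wser (m : ℕ) : PowerSeries ℤ :=
  PowerSeries.mk (fun n => if Even n then ((n / 2 + m).choose m : ℤ) else 0)

open PowerSeries in
theorem Wser_zero : (1 - X ^ 2) * Wser 0 = 1 := by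
  ext n
  rw [sub_mul, one_mul, map_sub, coeff_X_pow_mul']
  rcases n with _ | _ | n
  · simp [Wser]
  · simp [Wser, coeff_one]
  · simp [Wser, coeff_one, Nat.even_add_one]

open PowerSeries in
theorem Wser_succ (m : ℕ) : (1 - X ^ 2) * Wser (m+1) = Wser m := by
  ext n
  rw [sub_mul, one_mul, map_sub, coeff_X_pow_mul']
  rcases n with _ | _ | n
  · simp [Wser]
  · simp [Wser]
  · have h : (n + 1 + 1) / 2 = n / 2 + 1 := by omega
    by_cases hn : Even n
    · simp [Wser, Nat.even_add_one, h, hn]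
      have := Nat.choose_succ_succ (n/2 + 1 + m) m
      rw [show n / 2 + 1 + (m+1) = (n/2 + 1 + m).succ by omega, show n / 2 + (m+1) = n/2+1+m by omega]
      rw [this]; push_cast; simp
    · simp [Wser, Nat.even_add_one, hn]

open PowerSeries in
theorem Wser_pow (m : ℕ) : (1 - X ^ 2) ^ (m+1) * Wser m = 1 := by
  induction m with
  | zero => simpa using Wser_zero
  | succ m ih => rw [pow_succ, mul_assoc, Wser_succ, ih]

theorem intChoose_term (k i m : ℕ) :
    intChoose ((k:ℤ) - i + m) m = if i ≤ k then ((k - i + m).choose m : ℤ) else 0 := by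
  unfold intChoose
  split_ifs with h1 h2 h2
  · congr 2; omega
  · rw [Nat.choose_eq_zero_of_lt (by omega)]; simp
  · omega
  · rfl

open PowerSeries in
theorem coeff_one_add_X_pow (m a : ℕ) : coeff a ((1 + X : PowerSeries ℤ) ^ m) = (m.choose a : ℤ) := by
  have : ((1 + X : PowerSeries ℤ) ^ m) = (((1 + Polynomial.X : Polynomial ℤ) ^ m : Polynomial ℤ) : PowerSeries ℤ) := by
    simp
  rw [this, Polynomial.coeff_coe, Polynomial.coeff_one_add_X_pow]

theorem sum_even_s10 (f : ℕ → ℤ) (k : ℕ) (hf : ∀ i, i < k → f (2*i+1) = 0) :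
    ∑ a ∈ Finset.range (2*k+1), f a = ∑ i ∈ Finset.range (k+1), f (2*i) := by
  induction k with
  | zero => simp
  | succ k ih =>
    rw [Finset.sum_range_succ _ (k+1), ← ih (fun i hi => hf i (by omega)),
      show 2*(k+1)+1 = 2*k+1+1+1 by ring,
      Finset.sum_range_succ, Finset.sum_range_succ, hf k (by omega)]
    simp [mul_add]

theorem sum_odd (f : ℕ → ℤ) (k : ℕ) (hf : ∀ i, i ≤ k → f (2*i) = 0) :
    ∑ a ∈ Finset.range (2*k+1+1), f a = ∑ i ∈ Finset.range (k+1), f (2*i+1) := by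
  induction k with
  | zero => have := hf 0 le_rfl; simp [Finset.sum_range_succ] at *; exact this
  | succ k ih =>
    rw [Finset.sum_range_succ _ (k+1), ← ih (fun i hi => hf i (by omega)),
      show 2*(k+1)+1+1 = 2*k+1+1+1+1 by ring,
      Finset.sum_range_succ, Finset.sum_range_succ, show 2*k+1+1 = 2*(k+1) by ring,
      hf (k+1) le_rfl, add_zero]
    rfl

theorem range_swap (f : ℕ → ℤ) (a b : ℕ) (ha : ∀ i, a ≤ i → f i = 0) (hb : ∀ i, b ≤ i → f i = 0) :
    ∑ i ∈ Finset.range a, f i = ∑ i ∈ Finset.range b, f i := by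
  rcases le_total a b with h | h
  · exact Finset.sum_subset (by simpa using h) (fun i _ hi => ha i (by simpa using hi))
  · exact (Finset.sum_subset (by simpa using h) (fun i _ hi => hb i (by simpa using hi))).symm

open PowerSeries in
theorem P_coeff (t k : ℕ) : Pfun (2*(t+1)) k = coeff (2*k) ((1 + X) ^ (2*t) * Wser (2*t)) := by
  rw [coeff_mul, Finset.Nat.sum_antidiagonal_eq_sum_range_succ_mk]
  simp only [coeff_one_add_X_pow, Wser, coeff_mk]
  rw [sum_even_s10]
  · unfold Pfun
    rw [range_swap _ _ (k+1)]
    · refine Finset.sum_congr rfl fun i hi => ?_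
      have hi : i ≤ k := by simpa [Nat.lt_succ_iff] using hi
      have e : (k:ℤ) - i + (2*(t+1) : ℕ) - 2 = (k:ℤ) - i + (2*t : ℕ) := by push_cast; ring
      rw [e, show 2*(t+1)-2 = 2*t by omega, intChoose_term k i (2*t), if_pos hi,
        ← Nat.mul_sub, if_pos (by simp), Nat.mul_div_cancel_left _ (by norm_num)]
    · intro i hi
      rw [Nat.choose_eq_zero_of_lt (by omega)]; simp
    · intro i hi
      have e : (k:ℤ) - i + (2*(t+1) : ℕ) - 2 = (k:ℤ) - i + (2*t : ℕ) := by push_cast; ring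
      rw [e, show 2*(t+1)-2 = 2*t by omega, intChoose_term k i (2*t), if_neg (by omega)]; simp
  · intro i hi
    rw [if_neg (by rw [Nat.even_iff]; omega)]; simp

open PowerSeries in
theorem Q_coeff (t k : ℕ) : Qfun (2*(t+1)) k = coeff (2*k+1) ((1 + X) ^ (2*t) * Wser (2*t)) := by
  rw [coeff_mul, Finset.Nat.sum_antidiagonal_eq_sum_range_succ_mk]
  simp only [coeff_one_add_X_pow, Wser, coeff_mk]
  rw [sum_odd]
  · unfold Qfun
    rw [range_swap _ _ (k+1)]
    · refine Finset.sum_congr rfl fun i hi => ?_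
      have hi : i ≤ k := by simpa [Nat.lt_succ_iff] using hi
      have e : (k:ℤ) - i + (2*(t+1) : ℕ) - 2 = (k:ℤ) - i + (2*t : ℕ) := by push_cast; ring
      rw [e, show 2*(t+1)-2 = 2*t by omega, intChoose_term k i (2*t), if_pos hi,
        show 2*k+1-(2*i+1) = 2*(k-i) by omega, if_pos (by simp), Nat.mul_div_cancel_left _ (by norm_num)]
    · intro i hi
      rw [Nat.choose_eq_zero_of_lt (by omega)]; simp
    · intro i hi
      have e : (k:ℤ) - i + (2*(t+1) : ℕ) - 2 = (k:ℤ) - i + (2*t : ℕ) := by push_cast; ring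
      rw [e, show 2*(t+1)-2 = 2*t by omega, intChoose_term k i (2*t), if_neg (by omega)]; simp
  · intro i hi
    rw [if_neg (by rw [Nat.even_iff]; omega)]; simp

noncomputable def Kser : PowerSeries ℤ := PowerSeries.mk fun n => (-1)^n * ((n:ℤ)+1)^2

open PowerSeries in
theorem Kser_eq : (1 + X)^3 * Kser = 1 - X := by
  have h1 : (1 + X) * Kser = mk fun n => (-1)^n * (2*(n:ℤ)+1) := by
    ext n
    rcases n with _ | n
    · simp [Kser]
    · rw [aux_coeff]; simp only [Kser, coeff_mk]; push_cast; ring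
  have h2 : (1 + X) * (mk fun n => (-1)^n * (2*(n:ℤ)+1)) = mk fun n => if n = 0 then (1:ℤ) else (-1)^n * 2 := by
    ext n
    rcases n with _ | n
    · simp
    · rw [aux_coeff]; simp only [coeff_mk]; rcases n with _ | n <;> simp <;> ring
  have h3 : (1 + X) * (mk fun n => if n = 0 then (1:ℤ) else (-1)^n * 2) = 1 - X := by
    ext n
    rcases n with _ | _ | n
    · simp
    · rw [aux_coeff]; simp [coeff_one]
    · rw [aux_coeff]; simp [coeff_one, coeff_X]; ring
  rw [← h3, ← h2, ← h1]; ring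

open PowerSeries in
theorem main_coeff (n : ℕ) :
    ∑ t ∈ Finset.range (n+1), (-4:ℤ)^t * coeff (n - t) ((1 + X) ^ (2*t) * Wser (2*t))
      = (-1)^n * ((n:ℤ)+1)^2 := by
  obtain ⟨U, hU⟩ : ∃ U : PowerSeries ℤ, U * (1 - X) = 1 := ⟨mk 1, mk_one_mul_one_sub_eq_one ℤ⟩
  obtain ⟨E, hE⟩ : ∃ E : PowerSeries ℤ, E * (1 + X) = 1 := by
    refine ⟨mk fun n => (-1)^n, ?_⟩
    ext n
    rw [mul_comm]
    rcases n with _ | n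
    · simp
    · rw [aux_coeff]; simp [coeff_one]; ring
  have hG : ∀ t, (1 + X) ^ (2*t) * Wser (2*t) = U^(2*t) * Wser 0 := by
    intro t
    have h1 := Wser_pow (2*t)
    have h2 : (U * (1 - X))^(2*t) = 1 := by rw [hU, one_pow]
    calc (1 + X) ^ (2*t) * Wser (2*t)
        = (1 + X) ^ (2*t) * Wser (2*t) * (U * (1 - X))^(2*t) * ((1 - X ^ 2) * Wser 0) := by
          rw [h2, Wser_zero]; ring
      _ = U^(2*t) * Wser 0 * ((1 - X ^ 2) ^ (2*t+1) * Wser (2*t)) := by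
          rw [show (1 - X^2 : PowerSeries ℤ) = (1+X)*(1-X) by ring, mul_pow, mul_pow]; ring
      _ = _ := by rw [h1, mul_one]
  set S : PowerSeries ℤ := ∑ t ∈ Finset.range (n+1), (-4 * X * U^2)^t * Wser 0 with hS
  have hc : ∑ t ∈ Finset.range (n+1), (-4:ℤ)^t * coeff (n - t) ((1 + X) ^ (2*t) * Wser (2*t))
      = coeff n S := by
    rw [hS, map_sum]
    refine Finset.sum_congr rfl fun t ht => ?_
    have ht : t ≤ n := by simpa [Nat.lt_succ_iff] using ht
    rw [hG, show (-4 * X * U^2)^t * Wser 0 = C ((-4:ℤ)^t) * (X^t * (U^(2*t) * Wser 0)) by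
      simp only [map_pow, map_neg, map_ofNat, mul_pow, pow_mul]; ring]
    rw [coeff_C_mul, coeff_X_pow_mul', if_pos ht]
  have hgeo := geom_sum_mul (-4 * X * U^2) (n+1)
  have hS2 : S = Kser - X^(n+1) * ((-4 * U^2)^(n+1) * (1-X) * (1-X) * (1 + X) * Wser 0 * E^3) := by
    have e1 : S * (1 + 4 * X * U^2) = Wser 0 - (-4 * X * U^2)^(n+1) * Wser 0 := by
      rw [hS, ← Finset.sum_mul]; linear_combination (-Wser 0) * hgeo
    have e2 : S * (1 + X)^2 = (1-X)^2 * (Wser 0 - (-4 * X * U^2)^(n+1) * Wser 0) := by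
      rw [← e1]; linear_combination (-4 * X * S * (U*(1-X)+1)) * hU
    have e3 : S * (1+X)^3 = (1+X)^3 * Kser - (-4 * X * U^2)^(n+1) * Wser 0 * (1-X)^2 * (1+X) := by
      rw [Kser_eq]; linear_combination (1+X) * e2 + (1-X) * Wser_zero
    have hE3 : E^3 * (1+X)^3 = 1 := by rw [← mul_pow, hE, one_pow]
    have e4 : (-4 * X * U^2)^(n+1) = X^(n+1) * (-4 * U^2)^(n+1) := by rw [← mul_pow]; ring
    rw [e4] at e3
    linear_combination E^3 * e3 + (Kser - S) * hE3
  rw [hc, hS2, map_sub, coeff_X_pow_mul', if_neg (by omega)]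
  simp [Kser]

theorem stmt10 (n : ℕ) (hn : Even n) :
    ((n : ℤ) + 1) ^ 2 =
      ∑ j ∈ (Finset.Icc 1 (n + 1)).filter (fun j => Odd j),
        (4 : ℤ) ^ (j - 1) * Pfun (2 * j) ((n + 1 - j) / 2)
      - ∑ j ∈ (Finset.Icc 2 n).filter (fun j => Even j),
        (4 : ℤ) ^ (j - 1) * Qfun (2 * j) ((n - j) / 2) := by
  have h := main_coeff n
  rw [hn.neg_one_pow, one_mul] at h
  rw [← h]
  have hs : (Finset.Icc 2 n).filter (fun j => Even j) = (Finset.Icc 1 (n+1)).filter (fun j => ¬ Odd j) := by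
    ext j
    simp only [Finset.mem_filter, Finset.mem_Icc, Nat.not_odd_iff_even]
    rw [Nat.even_iff] at *
    omega
  rw [hs, Finset.sum_filter, Finset.sum_filter, ← Finset.sum_sub_distrib]
  have hI : Finset.Icc 1 (n+1) = Finset.Ico (0+1) (n+1+1) := by ext j; simp
  rw [hI, ← Finset.sum_Ico_add', ← Finset.range_eq_Ico]
  refine Finset.sum_congr rfl fun t ht => ?_
  have ht : t ≤ n := by simpa [Nat.lt_succ_iff] using ht
  rw [Nat.even_iff] at hn
  rcases Nat.even_or_odd t with h | h
  · rw [if_pos h.add_one, if_neg (by simpa using h.add_one), P_coeff]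
    have : 2 * ((n + 1 - (t+1))/2) = n - t := by rw [Nat.even_iff] at h; omega
    rw [this, h.neg_pow]; simp
  · have h' : ¬ Odd (t+1) := by simpa using h.add_one
    rw [if_neg h', if_pos h', Q_coeff]
    have : 2 * ((n - (t+1))/2) + 1 = n - t := by rw [Nat.odd_iff] at h; omega
    rw [this, h.neg_pow]; simp
end
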